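/- Maximal number of bicolored cycles when all bubbles but one are planar: Let σ_1, σ_2, σ_3 be permutations of Fin n and let W_0, W_1, …, W_m be the bubbles (the orbits of the subgroup generated by {σ_a⁻¹ * σ_b : 1 ≤ a, b ≤ 3}), with restricted bubbles B_j = (σ_1|_{W_j}, σ_2|_{W_j}, σ_3|_{W_j}). Suppose B_1, …, B_m are planar (B_0 is arbitrary). Then the maximum of C_0((σ_0, σ_1, σ_2, σ_3)) over all permutations σ_0 of Fin n making the colored graph connected equals C_1(B_0) + Σ_{j=1}^{m} (C_1(B_j) − 3), where C_1(B_j) is the maximum over all bijections π : W_j ≃ σ_1(W_j) of Σ_{c=1}^{3} (number of orbits on W_j of (σ_c|_{W_j})⁻¹ ∘ π). -/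

import Mathlib

/-- The setoid on `α` whose classes are the cycles (orbits) of the permutation `π`. -/
def permSetoid {α : Type*} (π : Equiv.Perm α) : Setoid α :=
  ⟨π.SameCycle, ⟨fun _ => ⟨0, by simp⟩, fun h => h.symm, fun h h' => h.trans h'⟩⟩

/-- The number of cycles (orbits) of a permutation. -/
noncomputable def numCycles {α : Type*} (π : Equiv.Perm α) : ℕ :=
  Nat.card (Quotient (permSetoid π))

/-- Connectivity of the colored graph `(σ 0, σ 1, σ 2, σ 3)` (case `d = 3`). -/
def ColoredConnected {n : ℕ} (σ : Fin 4 → Equiv.Perm (Fin n)) : Prop :=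
  ∀ x y : Fin n,
    ∃ g ∈ Subgroup.closure {g : Equiv.Perm (Fin n) | ∃ a b : Fin 4, g = (σ a)⁻¹ * σ b},
      g x = y

/-- `C_0(G) = Σ_{c=1}^{3} C_{0c}(G)` at `d = 3`. -/
noncomputable def C0 {n : ℕ} (σ : Fin 4 → Equiv.Perm (Fin n)) : ℕ :=
  numCycles ((σ 1)⁻¹ * σ 0) + numCycles ((σ 2)⁻¹ * σ 0) + numCycles ((σ 3)⁻¹ * σ 0)

/-- The subgroup generated by the bicolored permutations of the colors `1, 2, 3` (given as
`τ 0, τ 1, τ 2`): its orbits are the (white vertex sets of the) bubbles. -/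
def bubbleSubgroup {n : ℕ} (τ : Fin 3 → Equiv.Perm (Fin n)) :
    Subgroup (Equiv.Perm (Fin n)) :=
  Subgroup.closure {g : Equiv.Perm (Fin n) | ∃ a b : Fin 3, g = (τ a)⁻¹ * τ b}

/-- The number of orbits (cycles) of the permutation `π` entirely contained in `W`. -/
noncomputable def orbitsIn {n : ℕ} (π : Equiv.Perm (Fin n)) (W : Set (Fin n)) : ℕ :=
  Nat.card {q : Quotient (permSetoid π) //
    ∀ x : Fin n, Quotient.mk (permSetoid π) x = q → x ∈ W}

/-- The colored graph with colors `{0,1,2,3}` obtained by adjoining the pairing `σ₀` as the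
color 0 to the bubble data `τ = (τ 0, τ 1, τ 2)` (standing for colors `1,2,3`). -/
def withZero {n : ℕ} (σ₀ : Equiv.Perm (Fin n)) (τ : Fin 3 → Equiv.Perm (Fin n)) :
    Fin 4 → Equiv.Perm (Fin n) :=
  Fin.cons σ₀ τ


set_option linter.unusedSectionVars false

namespace MCB

open Equiv

noncomputable def nb {β : Type*} (s : Setoid β) : ℕ := Nat.card (Quotient s)

section setoids
variable {β : Type*} [Finite β]

theorem nb_le_of_le {s t : Setoid β} (h : s ≤ t) : nb t ≤ nb s := by
  apply Nat.card_le_card_of_surjective (Quotient.map' (s₁ := s) (s₂ := t) id (fun _ _ hh => h hh))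
  intro q
  induction q using Quotient.inductionOn with
  | h a => exact ⟨Quotient.mk s a, rfl⟩

theorem nb_lt_of_le {s t : Setoid β} (h : s ≤ t) {x y : β} (h1 : t x y) (h2 : ¬ s x y) :
    nb t + 1 ≤ nb s := by
  have hs : Function.Surjective
      (Quotient.map' (s₁ := s) (s₂ := t) id (fun _ _ hh => h hh)) := by
    intro q
    induction q using Quotient.inductionOn with
    | h a => exact ⟨Quotient.mk s a, rfl⟩
  rcases Nat.lt_or_ge (nb t) (nb s) with h3 | h3
  · exact h3
  · exfalso
    have hb : Function.Bijective
      (Quotient.map' (s₁ := s) (s₂ := t) id (fun _ _ hh => h hh)) := by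
      apply Function.Surjective.bijective_of_nat_card_le hs h3
    apply h2
    have : Quotient.mk s x = Quotient.mk s y := by
      apply hb.1
      exact Quotient.sound h1
    exact Quotient.exact this

def pairS (x y : β) : Setoid β := Relation.EqvGen.setoid (fun u v => u = x ∧ v = y)

theorem pairS_rel (x y : β) : pairS x y x y := Relation.EqvGen.rel _ _ ⟨rfl, rfl⟩

theorem pairS_le {x y : β} {s : Setoid β} (h : s x y) : pairS x y ≤ s := by
  apply Setoid.eqvGen_le
  rintro u v ⟨rfl, rfl⟩
  exact h

theorem nb_le_sup_pair (s : Setoid β) (x y : β) : nb s ≤ nb (s ⊔ pairS x y) + 1 := by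
  classical
  let g : β → Quotient s := fun u => if s u y then Quotient.mk s x else Quotient.mk s u
  have hle : s ⊔ pairS x y ≤ Setoid.ker g := by
    apply sup_le
    · intro u v huv
      change g u = g v
      have : s u y ↔ s v y := ⟨fun h => s.trans' (s.symm' huv) h, fun h => s.trans' huv h⟩
      simp only [g, this]
      split_ifs
      · rfl
      · exact Quotient.sound huv
    · apply pairS_le
      change g x = g y
      simp only [g, s.refl' y, if_true]
      split_ifs <;> rfl
  let F : Quotient s → Option (Quotient (s ⊔ pairS x y)) := fun q =>
    if q = Quotient.mk s y then none else
      some (Quotient.map' (s₁ := s) (s₂ := s ⊔ pairS x y) id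
        (fun _ _ hh => (le_sup_left : s ≤ s ⊔ pairS x y) hh) q)
  have hF : Function.Injective F := by
    intro q1 q2
    induction q1 using Quotient.inductionOn with
    | h u =>
    induction q2 using Quotient.inductionOn with
    | h v =>
    intro h
    simp only [F] at h
    split_ifs at h with h1 h2 h2
    · rw [h1, h2]
    · have h3 : (s ⊔ pairS x y) u v := by
        have := Option.some.inj h
        exact Quotient.exact this
      have h4 : g u = g v := hle h3
      have h5 : ¬ s u y := fun hh => h1 (Quotient.sound hh)
      have h6 : ¬ s v y := fun hh => h2 (Quotient.sound hh)
      simpa [g, h5, h6] using h4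
  have := Nat.card_le_card_of_injective F hF
  rw [Finite.card_option] at this
  exact this

theorem nb_submod (u : Setoid β) : ∀ (k : ℕ) (s t : Setoid β), s ≤ t → nb s ≤ nb t + k →
    nb (s ⊔ u) + nb t ≤ nb (t ⊔ u) + nb s := by
  intro k
  induction k with
  | zero =>
    intro s t h hk
    have : t ≤ s := by
      intro x y hxy
      by_contra hn
      have := nb_lt_of_le h hxy hn
      omega
    have : s = t := le_antisymm h this
    subst this
    rfl
  | succ k ih =>
    intro s t h hk
    by_cases hts : t ≤ s
    · have : s = t := le_antisymm h hts
      subst this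
      rfl
    · have : ∃ x y, t x y ∧ ¬ s x y := by
        by_contra hn
        push Not at hn
        exact hts (fun {x y} hxy => hn x y hxy)
      obtain ⟨x, y, h1, h2⟩ := this
      have e1 : nb (s ⊔ pairS x y) + 1 ≤ nb s :=
        nb_lt_of_le le_sup_left ((le_sup_right : pairS x y ≤ _) (pairS_rel x y)) h2
      have e2 := nb_le_sup_pair (s ⊔ u) x y
      have e3 := ih (s ⊔ pairS x y) t (sup_le h (pairS_le h1)) (by omega)
      have e4 : s ⊔ u ⊔ pairS x y = s ⊔ pairS x y ⊔ u := by
        rw [sup_assoc, sup_comm u, sup_assoc]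
      rw [e4] at e2
      omega

end setoids

section cycles
variable {α : Type*} [Finite α] [DecidableEq α]

theorem mem_of_sameCycle {f : Perm α} {A : Set α} (hA : ∀ z ∈ A, f z ∈ A) {x y : α}
    (h : f.SameCycle x y) (hx : x ∈ A) : y ∈ A := by
  obtain ⟨i, hi⟩ := h.exists_nat_pow_eq
  rw [← hi]
  clear hi h
  induction i with
  | zero => simpa using hx
  | succ i ih => rw [pow_succ', Perm.mul_apply]; exact hA _ ih

theorem sameCycle_step (f : Perm α) (z : α) : f.SameCycle z (f z) := ⟨1, by simp⟩

theorem merge_same {f : Perm α} {x y : α} (h : ¬ f.SameCycle x y) :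
    (f * swap x y).SameCycle x y := by
  set f' := f * swap x y with hf'
  by_contra hn
  -- the orbit of `y` under `f`, if in the `f'`-cycle of `x`
  have key : y ∈ {z | f.SameCycle y z ∧ f'.SameCycle x z} := by
    refine mem_of_sameCycle (f := f) (x := f y) ?_ ?_ ?_
    · rintro z ⟨h1, h2⟩
      refine ⟨h1.trans (sameCycle_step f z), ?_⟩
      have hzx : z ≠ x := by rintro rfl; exact h h1.symm
      have hzy : z ≠ y := by rintro rfl; exact hn h2
      have : f' z = f z := by simp [hf', swap_apply_of_ne_of_ne hzx hzy]
      rw [← this]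
      exact h2.trans (sameCycle_step f' z)
    · exact (sameCycle_step f y).symm
    · refine ⟨sameCycle_step f y, ?_⟩
      have : f' x = f y := by simp [hf']
      rw [← this]
      exact sameCycle_step f' x
  exact hn key.2

theorem permSetoid_le_of {f : Perm α} {s : Setoid α} (h : ∀ z, s z (f z)) :
    permSetoid f ≤ s := by
  intro x y hxy
  exact mem_of_sameCycle (A := {z | s x z}) (fun z hz => s.trans' hz (h z)) hxy (s.refl' x)

theorem merge_le {f : Perm α} {x y : α} (h : ¬ f.SameCycle x y) :
    permSetoid f ≤ permSetoid (f * swap x y) := by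
  have hm := merge_same h
  apply permSetoid_le_of
  intro z
  change (f * swap x y).SameCycle z (f z)
  by_cases hzx : z = x
  · subst hzx
    have : f z = (f * swap z y) y := by simp
    rw [this]
    exact hm.trans (sameCycle_step _ y)
  by_cases hzy : z = y
  · subst hzy
    have : f z = (f * swap x z) x := by simp
    rw [this]
    exact hm.symm.trans (sameCycle_step _ x)
  have : f z = (f * swap x y) z := by simp [swap_apply_of_ne_of_ne hzx hzy]
  rw [this]
  exact sameCycle_step _ z

theorem nc_merge {f : Perm α} {x y : α} (h : ¬ f.SameCycle x y) :
    numCycles (f * swap x y) + 1 = numCycles f := by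
  have h1 : nb (permSetoid (f * swap x y)) + 1 ≤ nb (permSetoid f) :=
    nb_lt_of_le (merge_le h) (merge_same h) h
  have h2 := nb_le_sup_pair (permSetoid f) x y
  have h3 : nb (permSetoid f ⊔ pairS x y) ≤ nb (permSetoid (f * swap x y)) := by
    apply nb_le_of_le
    apply permSetoid_le_of
    intro z
    have hp : (permSetoid f ⊔ pairS x y) x y :=
      (le_sup_right : pairS x y ≤ permSetoid f ⊔ pairS x y) (pairS_rel x y)
    have hs : ∀ z, (permSetoid f ⊔ pairS x y) z (f z) := fun z =>
      (le_sup_left : permSetoid f ≤ permSetoid f ⊔ pairS x y) (sameCycle_step f z)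
    by_cases hzx : z = x
    · subst hzx
      simp only [Perm.mul_apply, swap_apply_left]
      exact Setoid.trans' _ hp (hs y)
    by_cases hzy : z = y
    · subst hzy
      simp only [Perm.mul_apply, swap_apply_right]
      exact Setoid.trans' _ (Setoid.symm' _ hp) (hs x)
    simp only [Perm.mul_apply, swap_apply_of_ne_of_ne hzx hzy]
    exact hs z
  change nb _ + 1 = nb _
  omega

theorem split_not_same {f : Perm α} {x y : α} (hxy : x ≠ y) (h : f.SameCycle x y) :
    ¬ (f * swap x y).SameCycle x y := by
  have hex : ∃ k : ℕ, (f ^ k) x = y := h.exists_nat_pow_eq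
  classical
  set k := Nat.find hex with hk
  have hky : (f ^ k) x = y := Nat.find_spec hex
  have hmin : ∀ i, i < k → (f ^ i) x ≠ y := fun i hi => Nat.find_min hex hi
  have hk0 : 0 < k := by
    rcases Nat.eq_zero_or_pos k with h0 | h0
    · rw [h0] at hky; simp at hky; exact absurd hky hxy
    · exact h0
  have hnx : ∀ i, 0 < i → i ≤ k → (f ^ i) x ≠ x := by
    intro i h0 hi hx
    apply hmin (k - i) (by omega)
    have : (f ^ (k - i)) ((f ^ i) x) = y := by
      rw [← Perm.mul_apply, ← pow_add, Nat.sub_add_cancel hi, hky]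
    rwa [hx] at this
  intro hs
  have hmem : x ∈ {z | ∃ i, 0 < i ∧ i ≤ k ∧ z = (f ^ i) x} := by
    refine mem_of_sameCycle (f := f * swap x y) (x := y) ?_ ?_ ?_
    · rintro z ⟨i, h0, hi, rfl⟩
      by_cases hik : i = k
      · refine ⟨1, by omega, by omega, ?_⟩
        rw [hik, hky]; simp
      · refine ⟨i + 1, by omega, by omega, ?_⟩
        rw [Perm.mul_apply, swap_apply_of_ne_of_ne (hnx i h0 hi) (hmin i (by omega)), pow_succ',
          Perm.mul_apply]
    · exact hs.symm
    · exact ⟨k, hk0, le_rfl, hky.symm⟩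
  obtain ⟨i, h0, hi, hx⟩ := hmem
  exact hnx i h0 hi hx.symm

theorem nc_split {f : Perm α} {x y : α} (hxy : x ≠ y) (h : f.SameCycle x y) :
    numCycles (f * swap x y) = numCycles f + 1 := by
  have := nc_merge (split_not_same hxy h)
  rw [mul_assoc, swap_mul_self, mul_one] at this
  exact this.symm

theorem permSetoid_inv (f : Perm α) : permSetoid f⁻¹ = permSetoid f := by
  ext x y
  exact Perm.sameCycle_inv

noncomputable def cyc (a b : Perm α) : ℕ := numCycles (a⁻¹ * b)

theorem cyc_comm (a b : Perm α) : cyc a b = cyc b a := by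
  unfold cyc numCycles
  rw [← permSetoid_inv (a⁻¹ * b)]
  simp

theorem cyc_self (a : Perm α) : cyc a a = Nat.card α := by
  unfold cyc numCycles
  rw [inv_mul_cancel]
  symm
  apply Nat.card_eq_of_bijective (fun x => Quotient.mk (permSetoid (1 : Perm α)) x)
  constructor
  · intro x y h
    have : (1 : Perm α).SameCycle x y := Quotient.exact h
    simpa using this
  · intro q
    induction q using Quotient.inductionOn with
    | h a => exact ⟨a, rfl⟩

end cycles

section graphs
variable {α : Type*} [Finite α] [DecidableEq α]

theorem aii (a : Perm α) (x : α) : a (a⁻¹ x) = x := by simp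
theorem iaa (a : Perm α) (x : α) : a⁻¹ (a x) = x := by simp
theorem swap_one (x : α) : swap x x = (1 : Perm α) := swap_self x

/-- the partition of white and black vertices generated by the edges of one color -/
def G (a : Perm α) : Setoid (α ⊕ α) :=
  Relation.EqvGen.setoid (fun u v => ∃ x, u = Sum.inl x ∧ v = Sum.inr (a x))

theorem G_rel (a : Perm α) (x : α) : G a (Sum.inl x) (Sum.inr (a x)) :=
  Relation.EqvGen.rel _ _ ⟨x, rfl, rfl⟩

theorem rel_of_G_le {a : Perm α} {s : Setoid (α ⊕ α)} (h : G a ≤ s) (x : α) :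
    s (Sum.inl x) (Sum.inr (a x)) := h (G_rel a x)

theorem G_le {a : Perm α} {s : Setoid (α ⊕ α)} (h : ∀ x, s (Sum.inl x) (Sum.inr (a x))) :
    G a ≤ s := by
  apply Setoid.eqvGen_le
  rintro u v ⟨x, rfl, rfl⟩
  exact h x

/-- if two white vertices joined by the swap are related then old edges are related -/
theorem G_le_of_swap {a : Perm α} {x y : α} {s : Setoid (α ⊕ α)}
    (h : G (a * swap x y) ≤ s) (hxy : s (Sum.inl x) (Sum.inl y)) : G a ≤ s := by
  apply G_le
  intro z
  by_cases hzx : z = x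
  · subst hzx
    have := rel_of_G_le h y
    simp only [Perm.mul_apply, swap_apply_right] at this
    exact s.trans' hxy this
  by_cases hzy : z = y
  · subst hzy
    have := rel_of_G_le h x
    simp only [Perm.mul_apply, swap_apply_left] at this
    exact s.trans' (s.symm' hxy) this
  have := rel_of_G_le h z
  simpa only [Perm.mul_apply, swap_apply_of_ne_of_ne hzx hzy] using this

theorem rel_of_sameCycle {a b : Perm α} {s : Setoid (α ⊕ α)} (ha : G a ≤ s) (hb : G b ≤ s)
    {x y : α} (h : (a⁻¹ * b).SameCycle x y) : s (Sum.inl x) (Sum.inl y) := by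
  refine mem_of_sameCycle (A := {z | s (Sum.inl x) (Sum.inl z)}) ?_ h (s.refl' _)
  intro z hz
  have h1 := rel_of_G_le hb z
  have h2 := rel_of_G_le ha ((a⁻¹ * b) z)
  simp only [Perm.mul_apply, aii] at h2
  exact s.trans' hz (s.trans' h1 (s.symm' h2))

def S3 (a b c : Perm α) : Setoid (α ⊕ α) := G a ⊔ G b ⊔ G c

theorem le1 (a b c : Perm α) : G a ≤ S3 a b c := le_sup_left.trans le_sup_left
theorem le2 (a b c : Perm α) : G b ≤ S3 a b c := le_sup_right.trans le_sup_left
theorem le3 (a b c : Perm α) : G c ≤ S3 a b c := le_sup_right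
theorem S3_le {a b c : Perm α} {s : Setoid (α ⊕ α)} (h1 : G a ≤ s) (h2 : G b ≤ s)
    (h3 : G c ≤ s) : S3 a b c ≤ s := sup_le (sup_le h1 h2) h3

theorem S3_comm12 (a b c : Perm α) : S3 a b c = S3 b a c := by
  unfold S3; rw [sup_comm (G a)]
theorem S3_comm23 (a b c : Perm α) : S3 a b c = S3 a c b := by
  unfold S3; rw [sup_assoc, sup_comm (G b), ← sup_assoc]

noncomputable def FF (a b c : Perm α) : ℕ := cyc a b + cyc a c + cyc b c

theorem FF_comm12 (a b c : Perm α) : FF a b c = FF b a c := by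
  unfold FF; rw [cyc_comm a b]; omega
theorem FF_comm23 (a b c : Perm α) : FF a b c = FF a c b := by
  unfold FF; rw [cyc_comm b c]; omega

/-- modify `s` so that `v` is sent to `w` -/
def par (s : Perm α) (v w : α) : Perm α := s * swap v (s⁻¹ w)

theorem par_apply (s : Perm α) (v w : α) : par s v w v = w := by simp [par]

theorem par_of_eq {s : Perm α} {v w : α} (h : s v = w) : par s v w = s := by
  subst h; rw [par, iaa, swap_one, mul_one]

theorem par_ne {s : Perm α} {v w : α} (h : s v ≠ w) : v ≠ s⁻¹ w := by
  rintro h1; apply h; rw [h1]; simp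

theorem par_apply_of_eq {s p : Perm α} {v w x : α} (hp : p v = w) (hx : p x = s x) :
    par s v w x = s x := by
  by_cases hxv : x = v
  · subst hxv; rw [par_apply, ← hp, hx]
  · have : x ≠ s⁻¹ w := by
      intro h
      have h2 : s x = w := by rw [h]; simp
      rw [← hx, ← hp] at h2
      exact hxv (p.injective h2)
    rw [par, Perm.mul_apply, swap_apply_of_ne_of_ne hxv this]

theorem cyc_par {a s : Perm α} {v w : α} (ha : a v = w) (hs : s v ≠ w) :
    cyc a (par s v w) = cyc a s + 1 := by
  unfold cyc par
  rw [← mul_assoc]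
  apply nc_split (par_ne hs)
  have := sameCycle_step (a⁻¹ * s) (s⁻¹ w)
  have h2 : (a⁻¹ * s) (s⁻¹ w) = v := by rw [← ha]; simp
  rw [h2] at this
  exact this.symm

theorem cyc_swap_split {a s : Perm α} {x y : α} (hxy : x ≠ y) (h : (a⁻¹ * s).SameCycle x y) :
    cyc a (s * swap x y) = cyc a s + 1 := by
  unfold cyc
  rw [← mul_assoc]
  exact nc_split hxy h

theorem cyc_swap_merge {a s : Perm α} {x y : α} (h : ¬ (a⁻¹ * s).SameCycle x y) :
    cyc a (s * swap x y) + 1 = cyc a s := by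
  unfold cyc
  rw [← mul_assoc]
  exact nc_merge h

theorem cyc_merge_same {a s : Perm α} {x y : α} (h : ¬ (a⁻¹ * s).SameCycle x y) :
    (a⁻¹ * (s * swap x y)).SameCycle x y := by
  rw [← mul_assoc]
  exact merge_same h

theorem cyc_swap_ge {a s : Perm α} {x y : α} : cyc a s ≤ cyc a (s * swap x y) + 1 := by
  by_cases hxy : x = y
  · subst hxy; rw [swap_one, mul_one]; omega
  by_cases h : (a⁻¹ * s).SameCycle x y
  · rw [cyc_swap_split hxy h]; omega
  · rw [cyc_swap_merge h]

theorem cyc_swap_le {a s : Perm α} {x y : α} : cyc a (s * swap x y) ≤ cyc a s + 1 := by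
  have := cyc_swap_ge (a := a) (s := s * swap x y) (x := x) (y := y)
  rwa [mul_assoc, swap_mul_self, mul_one] at this

theorem nb_swap_le (t : Setoid (α ⊕ α)) (s : Perm α) (x y : α) :
    nb (t ⊔ G (s * swap x y)) ≤ nb (t ⊔ G s) + 1 := by
  have h1 := nb_le_sup_pair (t ⊔ G (s * swap x y)) (Sum.inl x) (Sum.inl y)
  have h2 : nb (t ⊔ G (s * swap x y) ⊔ pairS (Sum.inl x) (Sum.inl y)) ≤ nb (t ⊔ G s) := by
    apply nb_le_of_le
    apply sup_le (le_sup_left.trans le_sup_left)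
    apply G_le_of_swap (x := x) (y := y) (le_sup_right.trans le_sup_left)
    exact (le_sup_right : pairS (Sum.inl x) (Sum.inl y) ≤ _) (pairS_rel _ _)
  omega

theorem nb_swap_le_of_merge (t : Setoid (α ⊕ α)) {a s : Perm α} {x y : α} (ha : G a ≤ t)
    (h : ¬ (a⁻¹ * s).SameCycle x y) :
    t ⊔ G s ≤ t ⊔ G (s * swap x y) := by
  apply sup_le le_sup_left
  apply G_le_of_swap (x := x) (y := y) le_sup_right
  exact rel_of_sameCycle (ha.trans le_sup_left) le_sup_right (cyc_merge_same h)

theorem S3_mid (a b c : Perm α) : S3 a b c = G a ⊔ G c ⊔ G b := by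
  rw [S3_comm23]; rfl

theorem S3_par_le {a b c : Perm α} {v w : α} (ha : a v = w) :
    S3 a (par b v w) c ≤ S3 a b c := by
  apply S3_le (le1 _ _ _) _ (le3 _ _ _)
  unfold par
  apply G_le_of_swap (x := v) (y := b⁻¹ w)
  · rw [mul_assoc, swap_mul_self, mul_one]; exact le2 _ _ _
  · have h1 := rel_of_G_le (le1 a b c) v
    have h2 := rel_of_G_le (le2 a b c) (b⁻¹ w)
    simp only [aii] at h2
    rw [ha] at h1
    exact Setoid.trans' _ h1 (Setoid.symm' _ h2)

theorem euler_step {a b c : Perm α} {v w : α} (ha : a v = w) :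
    FF a b c + 2 * nb (S3 a (par b v w) c) ≤ FF a (par b v w) c + 2 * nb (S3 a b c) := by
  by_cases hb : b v = w
  · rw [par_of_eq hb]
  have h1 := cyc_par ha hb
  by_cases hs : (c⁻¹ * b).SameCycle v (b⁻¹ w)
  · have h2 := cyc_swap_split (par_ne hb) hs
    have h3 := nb_swap_le (G a ⊔ G c) b v (b⁻¹ w)
    rw [← S3_mid, ← S3_mid] at h3
    change cyc c (par b v w) = _ at h2
    change nb (S3 a (par b v w) c) ≤ _ at h3
    unfold FF
    rw [cyc_comm b c, cyc_comm (par b v w) c]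
    omega
  · have h2 := cyc_swap_merge hs
    have h3 := nb_le_of_le (nb_swap_le_of_merge (G a ⊔ G c) le_sup_right hs)
    rw [← S3_mid, ← S3_mid] at h3
    change cyc c (par b v w) + 1 = _ at h2
    change nb (S3 a (par b v w) c) ≤ _ at h3
    unfold FF
    rw [cyc_comm b c, cyc_comm (par b v w) c]
    omega

theorem cyc_le_nb (a c : Perm α) : cyc a c ≤ nb (S3 a a c) := by
  let f : α ⊕ α → Quotient (permSetoid (a⁻¹ * c)) :=
    Sum.elim (fun x => Quotient.mk _ x) (fun y => Quotient.mk _ (a⁻¹ y))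
  have ha : G a ≤ Setoid.ker f := by
    apply G_le
    intro x
    change f _ = f _
    simp [f]
  have hc : G c ≤ Setoid.ker f := by
    apply G_le
    intro x
    change f _ = f _
    simp only [f, Sum.elim_inl, Sum.elim_inr]
    apply Quotient.sound
    exact sameCycle_step (a⁻¹ * c) x
  have hle : S3 a a c ≤ Setoid.ker f := S3_le ha ha hc
  apply Nat.card_le_card_of_surjective (Quotient.lift f (fun _ _ h => hle h))
  intro q
  induction q using Quotient.inductionOn with
  | h x => exact ⟨Quotient.mk _ (Sum.inl x), rfl⟩

theorem euler (k : ℕ) : ∀ a b c : Perm α, {x | a x ≠ b x}.ncard ≤ k →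
    FF a b c ≤ Nat.card α + 2 * nb (S3 a b c) := by
  induction k with
  | zero =>
    intro a b c hk
    have : a = b := by
      ext x
      by_contra hne
      have h0 : {x | a x ≠ b x} = ∅ := by
        rw [← Set.ncard_eq_zero (Set.toFinite _)]; omega
      have : x ∈ {x | a x ≠ b x} := hne
      rw [h0] at this
      exact this
    subst this
    have := cyc_le_nb a c
    unfold FF
    rw [cyc_self]
    omega
  | succ k ih =>
    intro a b c hk
    by_cases h : ∃ v, a v ≠ b v
    · obtain ⟨v, hv⟩ := h
      have h1 := euler_step (a := a) (b := b) (c := c) (v := v) rfl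
      have h2 := ih a (par b v (a v)) c (by
        have hlt : {x | a x ≠ par b v (a v) x}.ncard < {x | a x ≠ b x}.ncard := by
          apply Set.ncard_lt_ncard _ (Set.toFinite _)
          refine ⟨?_, ?_⟩
          · intro x hx hx2
            apply hx
            rw [par_apply_of_eq rfl hx2]
            exact hx2
          · intro hss
            exact hss hv (par_apply _ _ _).symm
        omega)
      omega
    · push Not at h
      exact ih a b c (by simp [h])

theorem euler_ineq (a b c : Perm α) : FF a b c ≤ Nat.card α + 2 * nb (S3 a b c) :=
  euler _ a b c le_rfl

end graphs

section main
variable {α : Type*} [Finite α] [DecidableEq α]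

noncomputable def CC (a b c s : Perm α) : ℕ := cyc a s + cyc b s + cyc c s

theorem CC_comm12 (a b c s : Perm α) : CC a b c s = CC b a c s := by unfold CC; omega
theorem CC_comm23 (a b c s : Perm α) : CC a b c s = CC a c b s := by unfold CC; omega

def Good (a b c s : Perm α) : Prop :=
  ∃ p : Perm α, G p ≤ S3 a b c ∧
    CC a b c s + 3 * nb (S3 a b c) ≤ CC a b c p + 3 * nb (S3 a b c ⊔ G s)

theorem Good.comm12 {a b c s : Perm α} (h : Good a b c s) : Good b a c s := by
  unfold Good at *
  rw [S3_comm12 b a c]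
  simp only [CC_comm12 b a c]
  exact h

theorem Good.comm23 {a b c s : Perm α} (h : Good a b c s) : Good a c b s := by
  unfold Good at *
  rw [S3_comm23 a c b]
  simp only [CC_comm23 a c b]
  exact h

theorem Good.of_le {a b c s s' : Perm α} (h : Good a b c s')
    (hle : CC a b c s + 3 * nb (S3 a b c ⊔ G s') ≤ CC a b c s' + 3 * nb (S3 a b c ⊔ G s)) :
    Good a b c s := by
  obtain ⟨p, h1, h2⟩ := h
  exact ⟨p, h1, by omega⟩

/-- contraction step -/
theorem Good.of_par {a b c s : Perm α} {v w : α} (ha : a v = w) (hs : s v = w)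
    (h : Good a (par b v w) c s) : Good a b c s := by
  by_cases hb : b v = w
  · rwa [par_of_eq hb] at h
  obtain ⟨p, h1, h2⟩ := h
  refine ⟨p, h1.trans (S3_par_le ha), ?_⟩
  have e1 : cyc s (par b v w) = cyc s b + 1 := cyc_par hs hb
  have e2 : cyc p (par b v w) ≤ cyc p b + 1 := cyc_swap_le
  have e3 := nb_submod (G s) _ _ _ (S3_par_le (b := b) (c := c) ha) (Nat.le_add_left _ _)
  unfold CC at *
  rw [cyc_comm] at e1 e2
  rw [cyc_comm s b] at e1
  rw [cyc_comm p b] at e2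
  omega

/-- a single swap of the color `0` -/
theorem sw1 {a b c s : Perm α} {v w : α} (ha : a v = w) (hs : s v ≠ w)
    (h : (b⁻¹ * s).SameCycle v (s⁻¹ w) ∨ (c⁻¹ * s).SameCycle v (s⁻¹ w)) :
    CC a b c s + 3 * nb (S3 a b c ⊔ G (par s v w)) ≤
      CC a b c (par s v w) + 3 * nb (S3 a b c ⊔ G s) := by
  have h1 := cyc_par ha hs
  have h0 := nb_swap_le (S3 a b c) s v (s⁻¹ w)
  change nb (S3 a b c ⊔ G (par s v w)) ≤ _ at h0
  unfold CC
  by_cases hb : (b⁻¹ * s).SameCycle v (s⁻¹ w)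
  · have h2 : cyc b (par s v w) = _ := cyc_swap_split (par_ne hs) hb
    by_cases hc : (c⁻¹ * s).SameCycle v (s⁻¹ w)
    · have h3 : cyc c (par s v w) = _ := cyc_swap_split (par_ne hs) hc
      omega
    · have h3 : cyc c (par s v w) + 1 = _ := cyc_swap_merge hc
      have h4 : nb (S3 a b c ⊔ G (par s v w)) ≤ _ :=
        nb_le_of_le (nb_swap_le_of_merge (S3 a b c) (le3 _ _ _) hc)
      omega
  · have hc : (c⁻¹ * s).SameCycle v (s⁻¹ w) := h.resolve_left hb
    have h3 : cyc c (par s v w) = _ := cyc_swap_split (par_ne hs) hc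
    have h2 : cyc b (par s v w) + 1 = _ := cyc_swap_merge hb
    have h4 : nb (S3 a b c ⊔ G (par s v w)) ≤ _ :=
        nb_le_of_le (nb_swap_le_of_merge (S3 a b c) (le2 _ _ _) hb)
    omega

theorem same_par {b s : Perm α} {v w : α} (hb : b v = w) :
    (b⁻¹ * s).SameCycle v (s⁻¹ w) := by
  have := sameCycle_step (b⁻¹ * s) (s⁻¹ w)
  have h2 : (b⁻¹ * s) (s⁻¹ w) = v := by rw [← hb]; simp
  rw [h2] at this
  exact this.symm

/-- the double swap -/
theorem sw2 {a b c s : Perm α} {v1 v2 w1 w2 : α} (a1 : a v1 = w1) (a2 : a v2 = w2)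
    (b1 : b v1 = w2) (b2 : b v2 = w1) (hw : w1 ≠ w2)
    (s11 : s v1 ≠ w1) (s12 : s v1 ≠ w2) (s21 : s v2 ≠ w1) (s22 : s v2 ≠ w2)
    (hb11 : ¬ (b⁻¹ * s).SameCycle v1 (s⁻¹ w1))
    (hc11 : ¬ (c⁻¹ * s).SameCycle v1 (s⁻¹ w1))
    (hc12 : ¬ (c⁻¹ * s).SameCycle v1 (s⁻¹ w2))
    (hc21 : ¬ (c⁻¹ * s).SameCycle v2 (s⁻¹ w1))
    (hc22 : ¬ (c⁻¹ * s).SameCycle v2 (s⁻¹ w2)) :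
    par (par s v1 w1) v2 w2 v1 = w1 ∧
    CC a b c s + 3 * nb (S3 a b c ⊔ G (par (par s v1 w1) v2 w2)) ≤
      CC a b c (par (par s v1 w1) v2 w2) + 3 * nb (S3 a b c ⊔ G s) := by
  have hv : v1 ≠ v2 := by rintro rfl; exact hw (a1.symm.trans a2)
  set q1 := s⁻¹ w1 with hq1
  set q2 := s⁻¹ w2 with hq2
  have sq1 : s q1 = w1 := aii _ _
  have sq2 : s q2 = w2 := aii _ _
  have n1 : q1 ≠ q2 := by intro h; rw [h, sq2] at sq1; exact hw sq1.symm
  have n11 : v1 ≠ q1 := par_ne s11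
  have n12 : v1 ≠ q2 := par_ne s12
  have n21 : v2 ≠ q1 := par_ne s21
  have n22 : v2 ≠ q2 := par_ne s22
  set s1 := par s v1 w1 with hs1
  have es1 : s1 = s * swap v1 q1 := rfl
  have s1q2 : s1 q2 = w2 := by
    rw [es1, Perm.mul_apply, swap_apply_of_ne_of_ne n12.symm n1.symm, sq2]
  have q2' : s1⁻¹ w2 = q2 := by rw [← s1q2, iaa]
  set s2 := par s1 v2 w2 with hs2
  have es2 : s2 = s1 * swap v2 q2 := by rw [hs2, par, q2']
  have s1v2 : s1 v2 = s v2 := by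
    rw [es1, Perm.mul_apply, swap_apply_of_ne_of_ne hv.symm n21]
  have s2v1 : s2 v1 = w1 := by
    rw [es2, Perm.mul_apply, swap_apply_of_ne_of_ne hv n12, hs1, par_apply]
  have s2v2 : s2 v2 = w2 := par_apply _ _ _
  have s2o : ∀ z, z ≠ v1 → z ≠ v2 → z ≠ q1 → z ≠ q2 → s2 z = s z := by
    intro z h1 h2 h3 h4
    rw [es2, Perm.mul_apply, swap_apply_of_ne_of_ne h2 h4, es1, Perm.mul_apply,
      swap_apply_of_ne_of_ne h1 h3]
  refine ⟨s2v1, ?_⟩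
  have A1 : cyc a s1 = cyc a s + 1 := cyc_par a1 s11
  have A2 : cyc a s2 = cyc a s1 + 1 := cyc_par a2 (by rw [s1v2]; exact s22)
  have B1 : cyc b s1 + 1 = cyc b s := cyc_swap_merge hb11
  have B2 : cyc b s2 = cyc b s1 + 1 := by
    rw [es2]
    apply cyc_swap_split n22
    have hle : permSetoid (b⁻¹ * s) ≤ permSetoid (b⁻¹ * s1) := by
      rw [es1, ← mul_assoc]; exact merge_le hb11
    have m : (b⁻¹ * s1).SameCycle v1 q1 := by rw [es1]; exact cyc_merge_same hb11
    have m1 : (b⁻¹ * s1).SameCycle v1 q2 := hle (same_par b1)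
    have m2 : (b⁻¹ * s1).SameCycle v2 q1 := hle (same_par b2)
    exact m2.trans (m.symm.trans m1)
  have C1 : cyc c s ≤ cyc c s1 + 1 := cyc_swap_ge
  have C2 : cyc c s1 ≤ cyc c s2 + 1 := cyc_swap_ge
  have K : nb (S3 a b c ⊔ G s2) ≤ nb (S3 a b c ⊔ G s) := by
    apply nb_le_of_le
    apply sup_le le_sup_left
    set T := S3 a b c ⊔ G s2 with hT
    have Ta : G a ≤ T := (le1 a b c).trans le_sup_left
    have Tb : G b ≤ T := (le2 a b c).trans le_sup_left
    have Tc : G c ≤ T := (le3 a b c).trans le_sup_left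
    have Ts : G s2 ≤ T := le_sup_right
    have t1 : T (Sum.inl v1) (Sum.inr w1) := a1 ▸ rel_of_G_le Ta v1
    have t2 : T (Sum.inl v1) (Sum.inr w2) := b1 ▸ rel_of_G_le Tb v1
    have t3 : T (Sum.inl v1) (Sum.inl v2) :=
      T.trans' t2 (T.symm' (a2 ▸ rel_of_G_le Ta v2))
    -- one step of the `0c` cycle for an untouched vertex
    have step : ∀ z, z ≠ v1 → z ≠ v2 → z ≠ q1 → z ≠ q2 →
        T (Sum.inl z) (Sum.inl ((c⁻¹ * s) z)) := by
      intro z h1 h2 h3 h4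
      have e1 := rel_of_G_le Ts z
      rw [s2o z h1 h2 h3 h4] at e1
      have e2 := rel_of_G_le Tc ((c⁻¹ * s) z)
      rw [Perm.mul_apply, aii] at e2
      exact T.trans' e1 (T.symm' e2)
    have cstep : ∀ z, T (Sum.inl ((c⁻¹ * s) z)) (Sum.inr (s z)) := by
      intro z
      have e2 := rel_of_G_le Tc ((c⁻¹ * s) z)
      rwa [Perm.mul_apply, aii] at e2
    have hV : ∀ v, (v = v1 ∨ v = v2) → T (Sum.inl v1) (Sum.inr (s v)) := by
      intro v hv'
      by_contra hcon
      have vT : T (Sum.inl v1) (Sum.inl v) := by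
        rcases hv' with rfl | rfl
        · exact T.refl' _
        · exact t3
      have nq1 : ¬ (c⁻¹ * s).SameCycle v q1 := by
        rcases hv' with rfl | rfl <;> assumption
      have nq2 : ¬ (c⁻¹ * s).SameCycle v q2 := by
        rcases hv' with rfl | rfl <;> assumption
      have : v ∈ {z | (c⁻¹ * s).SameCycle v z ∧ ¬ T (Sum.inl v1) (Sum.inl z)} := by
        refine mem_of_sameCycle (f := c⁻¹ * s) (x := (c⁻¹ * s) v) ?_
          (sameCycle_step _ v).symm ?_
        · rintro z ⟨h1, h2⟩
          refine ⟨h1.trans (sameCycle_step _ z), fun h3 => h2 ?_⟩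
          refine T.trans' h3 (T.symm' (step z ?_ ?_ ?_ ?_))
          · rintro rfl; exact h2 (T.refl' _)
          · rintro rfl; exact h2 t3
          · rintro rfl; exact nq1 h1
          · rintro rfl; exact nq2 h1
        · exact ⟨sameCycle_step _ v, fun h => hcon (T.trans' h (cstep v))⟩
      exact this.2 vT
    have hQ : ∀ q, (q = q1 ∨ q = q2) → T (Sum.inl v1) (Sum.inl q) := by
      intro q hq'
      have hsq : T (Sum.inl v1) (Sum.inl ((c⁻¹ * s) q)) := by
        refine T.trans' ?_ (T.symm' (cstep q))
        rcases hq' with rfl | rfl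
        · rw [sq1]; exact t1
        · rw [sq2]; exact t2
      have nv1 : ¬ (c⁻¹ * s).SameCycle v1 q := by
        rcases hq' with rfl | rfl <;> assumption
      have nv2 : ¬ (c⁻¹ * s).SameCycle v2 q := by
        rcases hq' with rfl | rfl <;> assumption
      have : q ∈ {z | (c⁻¹ * s).SameCycle q z ∧ T (Sum.inl v1) (Sum.inl z)} := by
        refine mem_of_sameCycle (f := c⁻¹ * s) (x := (c⁻¹ * s) q) ?_
          (sameCycle_step _ q).symm ⟨sameCycle_step _ q, hsq⟩
        rintro z ⟨h1, h2⟩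
        refine ⟨h1.trans (sameCycle_step _ z), ?_⟩
        by_cases z1 : z = q1
        · subst z1
          refine T.trans' ?_ (T.symm' (cstep _)); rw [sq1]; exact t1
        by_cases z2 : z = q2
        · subst z2
          refine T.trans' ?_ (T.symm' (cstep _)); rw [sq2]; exact t2
        refine T.trans' h2 (step z ?_ ?_ z1 z2)
        · rintro rfl; exact nv1 h1.symm
        · rintro rfl; exact nv2 h1.symm
      exact this.2
    apply G_le
    intro z
    by_cases z1 : z = v1
    · rw [z1]; exact hV _ (Or.inl rfl)
    by_cases z2 : z = v2
    · rw [z2]; exact T.trans' (T.symm' t3) (hV _ (Or.inr rfl))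
    by_cases z3 : z = q1
    · rw [z3, sq1]; exact T.trans' (T.symm' (hQ _ (Or.inl rfl))) t1
    by_cases z4 : z = q2
    · rw [z4, sq2]; exact T.trans' (T.symm' (hQ _ (Or.inr rfl))) t2
    rw [← s2o z z1 z2 z3 z4]
    exact rel_of_G_le Ts z
  unfold CC
  omega

end main

section induct
variable {α : Type*} [Finite α] [DecidableEq α]

def GZ (Z : Set α) (a : Perm α) : Setoid (α ⊕ α) :=
  Relation.EqvGen.setoid (fun u v => ∃ x ∈ Z, u = Sum.inl x ∧ v = Sum.inr (a x))

theorem GZ_congr {Z : Set α} {a b : Perm α} (h : ∀ x ∈ Z, a x = b x) : GZ Z a = GZ Z b := by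
  unfold GZ
  congr 1
  ext u v
  constructor
  · rintro ⟨x, hx, h1, h2⟩; exact ⟨x, hx, h1, by rw [h2, h x hx]⟩
  · rintro ⟨x, hx, h1, h2⟩; exact ⟨x, hx, h1, by rw [h2, h x hx]⟩

theorem GZ_le (Z : Set α) (a : Perm α) : GZ Z a ≤ G a := by
  apply Setoid.eqvGen_le
  rintro u v ⟨x, -, rfl, rfl⟩
  exact G_rel a x

structure H (Z Zb : Set α) (a b c a' b' c' : Perm α) : Prop where
  za : ∀ x, a x ∈ Zb ↔ x ∈ Z
  zb : ∀ x, b x ∈ Zb ↔ x ∈ Z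
  zc : ∀ x, c x ∈ Zb ↔ x ∈ Z
  ea : ∀ x, x ∉ Z → a' x = a x
  eb : ∀ x, x ∉ Z → b' x = b x
  ec : ∀ x, x ∉ Z → c' x = c x
  tab : ∀ x, x ∈ Z → a' x = b' x
  tac : ∀ x, x ∈ Z → a' x = c' x
  conn : ∀ x ∈ Z, ∀ y ∈ Z, (GZ Z a ⊔ GZ Z b ⊔ GZ Z c) (Sum.inl x) (Sum.inl y)
  eul : Nat.card α + 2 * nb (S3 a' b' c') ≤ FF a' b' c'

variable {Z Zb : Set α} {a b c a' b' c' : Perm α}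

theorem H.comm12 (h : H Z Zb a b c a' b' c') : H Z Zb b a c b' a' c' where
  za := h.zb
  zb := h.za
  zc := h.zc
  ea := h.eb
  eb := h.ea
  ec := h.ec
  tab x hx := (h.tab x hx).symm
  tac x hx := (h.tab x hx).symm.trans (h.tac x hx)
  conn := by rw [sup_comm (GZ Z b)]; exact h.conn
  eul := by rw [S3_comm12, FF_comm12]; exact h.eul

theorem H.comm23 (h : H Z Zb a b c a' b' c') : H Z Zb a c b a' c' b' where
  za := h.za
  zb := h.zc
  zc := h.zb
  ea := h.ea
  eb := h.ec
  ec := h.eb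
  tab := h.tac
  tac := h.tab
  conn := by rw [sup_assoc, sup_comm (GZ Z c), ← sup_assoc]; exact h.conn
  eul := by rw [S3_comm23, FF_comm23]; exact h.eul

theorem H.par (h : H Z Zb a b c a' b' c') {v w : α} (ha : a v = w) (hv : v ∉ Z) :
    H Z Zb a (par b v w) c a' (par b' v w) c' := by
  have hq : b⁻¹ w ∉ Z := by
    rw [← h.zb, aii, ← ha, h.za]; exact hv
  have hq' : b'⁻¹ w = b⁻¹ w := by
    rw [Perm.inv_eq_iff_eq, h.eb _ hq, aii]
  have e1 : MCB.par b v w = b * swap v (b⁻¹ w) := rfl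
  have e2 : MCB.par b' v w = b' * swap v (b⁻¹ w) := by rw [MCB.par, hq']
  have hsw : ∀ x, swap v (b⁻¹ w) x ∈ Z ↔ x ∈ Z := by
    intro x
    by_cases h1 : x = v
    · subst h1; rw [swap_apply_left]; tauto
    by_cases h2 : x = b⁻¹ w
    · rw [h2, swap_apply_right]; tauto
    rw [swap_apply_of_ne_of_ne h1 h2]
  have hfix : ∀ x ∈ Z, swap v (b⁻¹ w) x = x := by
    intro x hx
    apply swap_apply_of_ne_of_ne
    · rintro rfl; exact hv hx
    · rintro rfl; exact hq hx
  refine ⟨h.za, ?_, h.zc, h.ea, ?_, h.ec, ?_, h.tac, ?_, ?_⟩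
  · intro x
    rw [e1, Perm.mul_apply, h.zb, hsw]
  · intro x hx
    rw [e1, e2, Perm.mul_apply, Perm.mul_apply, h.eb]
    rwa [hsw]
  · intro x hx
    rw [e2, Perm.mul_apply, hfix x hx]
    exact h.tab x hx
  · rw [GZ_congr (a := MCB.par b v w) (b := b)]
    · exact h.conn
    · intro x hx
      rw [e1, Perm.mul_apply, hfix x hx]
  · have h1 := euler_step (a := a') (b := b') (c := c') (v := v) (w := w)
      (by rw [h.ea v hv, ha])
    have h2 := h.eul
    omega

def DD (a b c s : Perm α) : Set α := {x | a x = b x ∧ a x = c x ∧ a x = s x}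

theorem DD_comm12 (a b c s : Perm α) : DD a b c s = DD b a c s := by
  ext x; unfold DD; simp only [Set.mem_ofPred_eq]
  constructor
  · rintro ⟨h1, h2, h3⟩; exact ⟨h1.symm, h1 ▸ h2, h1 ▸ h3⟩
  · rintro ⟨h1, h2, h3⟩; exact ⟨h1.symm, h1 ▸ h2, h1 ▸ h3⟩

theorem DD_comm23 (a b c s : Perm α) : DD a b c s = DD a c b s := by
  ext x; unfold DD; simp only [Set.mem_ofPred_eq]; tauto

def IHt (Z Zb D : Set α) : Prop :=
  ∀ a b c a' b' c' s : Perm α, H Z Zb a b c a' b' c' → D ⊆ DD a b c s →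
    (∃ v, v ∉ Z ∧ v ∉ D ∧ v ∈ DD a b c s) → Good a b c s

theorem DD_par_mid {s : Perm α} {v w : α} (ha : a v = w) :
    DD a b c s ⊆ DD a (par b v w) c s := by
  rintro x ⟨h1, h2, h3⟩
  exact ⟨by rw [par_apply_of_eq ha h1]; exact h1, h2, h3⟩

theorem DD_par_last {s : Perm α} {v w : α} (ha : a v = w) :
    DD a b c s ⊆ DD a b c (par s v w) := by
  rintro x ⟨h1, h2, h3⟩
  exact ⟨h1, h2, by rw [par_apply_of_eq ha h3]; exact h3⟩

theorem contract {D : Set α} {s : Perm α} {v w : α} (h : H Z Zb a b c a' b' c') (ha : a v = w)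
    (hv : v ∉ Z) (hs : s v = w) (hD : D ⊆ DD a b c s) (hvD : v ∉ D) (ih : IHt Z Zb D) :
    Good a b c s := by
  apply Good.of_par ha hs
  apply Good.comm23
  apply Good.of_par ha hs
  apply ih _ _ _ _ _ _ _ ((h.par ha hv).comm23.par ha hv)
  · apply hD.trans
    apply (DD_par_mid ha).trans
    rw [DD_comm23]
    apply DD_par_mid ha
  · refine ⟨v, hv, hvD, ?_, ?_, ?_⟩
    · rw [par_apply, ha]
    · rw [par_apply, ha]
    · rw [ha, hs]

theorem stepFace {s : Perm α} (h : H Z Zb a b c a' b' c') (ih : IHt Z Zb (DD a b c s))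
    {x : α} (hx : x ∉ Z) (hn : ¬ (a x = b x ∧ a x = c x))
    (hf : a x = b x ∨ ∃ y, b x = a y ∧ b y = a x) : Good a b c s := by
  have hxD : x ∉ DD a b c s := fun hh => hn ⟨hh.1, hh.2.1⟩
  by_cases hab : a x = b x
  · by_cases hsx : s x = a x
    · exact contract h rfl hx hsx le_rfl hxD ih
    · apply Good.of_le _ (sw1 (v := x) rfl hsx (Or.inl (same_par hab.symm)))
      exact contract h rfl hx (par_apply _ _ _) (DD_par_last rfl) hxD ih
  obtain ⟨y, hy1, hy2⟩ := hf.resolve_left hab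
  have hy : y ∉ Z := by rw [← h.za, ← hy1, h.zb]; exact hx
  have hyD : y ∉ DD a b c s := by
    intro hh
    have := hh.1
    rw [← hy1, hy2] at this
    exact hab this.symm
  have ih' := ih
  rw [DD_comm12] at ih'
  have hxD' := hxD
  rw [DD_comm12] at hxD'
  have hyD' := hyD
  rw [DD_comm12] at hyD'
  by_cases s11 : s x = a x
  · exact contract h rfl hx s11 le_rfl hxD ih
  by_cases s12 : s x = b x
  · exact (contract h.comm12 rfl hx s12 le_rfl hxD' ih').comm12
  by_cases s22 : s y = a y
  · exact contract h rfl hy s22 le_rfl hyD ih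
  by_cases s21 : s y = b y
  · exact (contract h.comm12 rfl hy s21 le_rfl hyD' ih').comm12
  by_cases t11 : (b⁻¹ * s).SameCycle x (s⁻¹ (a x)) ∨ (c⁻¹ * s).SameCycle x (s⁻¹ (a x))
  · apply Good.of_le _ (sw1 (v := x) rfl s11 t11)
    exact contract h rfl hx (par_apply _ _ _) (DD_par_last rfl) hxD ih
  by_cases t22 : (b⁻¹ * s).SameCycle y (s⁻¹ (a y)) ∨ (c⁻¹ * s).SameCycle y (s⁻¹ (a y))
  · apply Good.of_le _ (sw1 (v := y) rfl s22 t22)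
    exact contract h rfl hy (par_apply _ _ _) (DD_par_last rfl) hyD ih
  by_cases t12 : (a⁻¹ * s).SameCycle x (s⁻¹ (b x)) ∨ (c⁻¹ * s).SameCycle x (s⁻¹ (b x))
  · apply Good.comm12
    apply Good.of_le _ (sw1 (v := x) rfl s12 t12)
    exact contract h.comm12 rfl hx (par_apply _ _ _) (DD_par_last rfl) hxD' ih'
  by_cases t21 : (a⁻¹ * s).SameCycle y (s⁻¹ (b y)) ∨ (c⁻¹ * s).SameCycle y (s⁻¹ (b y))
  · apply Good.comm12
    apply Good.of_le _ (sw1 (v := y) rfl s21 t21)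
    exact contract h.comm12 rfl hy (par_apply _ _ _) (DD_par_last rfl) hyD' ih'
  push Not at t11 t22 t12 t21
  rw [← hy1] at t22 s22
  rw [hy2] at t21 s21
  obtain ⟨e1, e2⟩ := sw2 (a := a) (b := b) (c := c) (s := s) rfl hy1.symm rfl hy2 hab
    s11 s12 s21 s22 t11.1 t11.2 t12.2 t21.2 t22.2
  apply Good.of_le _ e2
  refine contract h rfl hx e1 ?_ hxD ih
  exact (DD_par_last rfl).trans (DD_par_last hy1.symm)

/-- counting cycles when there is no short cycle outside of `T` -/
theorem count_cycles (f : Perm α) (T : Set α)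
    (h : ∀ x, x ∉ T → f x ≠ x ∧ f (f x) ≠ x) (hT : ∀ x ∈ T, f x = x) :
    3 * numCycles f ≤ Nat.card α + 2 * T.ncard := by
  classical
  have := Fintype.ofFinite α
  have := Fintype.ofFinite (Quotient (permSetoid f))
  have key : ∀ q : Quotient (permSetoid f), 3 ≤
      ∑ x : α with Quotient.mk (permSetoid f) x = q, (1 + 2 * if x ∈ T then 1 else 0) := by
    intro q
    induction q using Quotient.inductionOn with
    | h x =>
    by_cases hx : x ∈ T
    · calc 3 = 1 + 2 * (if x ∈ T then 1 else 0) := by simp [hx]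
        _ ≤ _ := Finset.single_le_sum (f := fun x => 1 + 2 * (if x ∈ T then 1 else 0))
          (fun _ _ => Nat.zero_le _) (by simp)
    · obtain ⟨h1, h2⟩ := h x hx
      have h3 : f (f x) ≠ f x := fun hh => h1 (f.injective hh)
      calc 3 = ∑ y ∈ ({x, f x, f (f x)} : Finset α), 1 := by
            rw [Finset.sum_const, Finset.card_eq_three.mpr
              ⟨x, f x, f (f x), h1.symm, h2.symm, h3.symm, rfl⟩]; rfl
        _ ≤ ∑ y ∈ ({x, f x, f (f x)} : Finset α), (1 + 2 * if y ∈ T then 1 else 0) :=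
            Finset.sum_le_sum (fun _ _ => Nat.le_add_right _ _)
        _ ≤ _ := by
            apply Finset.sum_le_sum_of_subset
            intro y hy
            simp only [Finset.mem_insert, Finset.mem_singleton] at hy
            simp only [Finset.mem_filter, Finset.mem_univ, true_and]
            apply Quotient.sound
            change f.SameCycle y x
            rcases hy with rfl | rfl | rfl
            · exact Perm.SameCycle.refl _ _
            · exact (sameCycle_step f x).symm
            · exact ((sameCycle_step f x).trans (sameCycle_step f (f x))).symm
  have e1 : ∑ q : Quotient (permSetoid f), 3 ≤ ∑ x : α, (1 + 2 * if x ∈ T then 1 else 0) := by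
    rw [← Finset.sum_fiberwise (s := Finset.univ) (g := fun x => Quotient.mk (permSetoid f) x)]
    exact Finset.sum_le_sum (fun q _ => key q)
  rw [Finset.sum_add_distrib, ← Finset.mul_sum, Finset.sum_boole] at e1
  simp only [Finset.sum_const, Finset.card_univ, smul_eq_mul, mul_one, Nat.cast_id] at e1
  rw [numCycles, Nat.card_eq_fintype_card, Nat.card_eq_fintype_card, Set.ncard_eq_toFinset_card']
  have e2 : T.toFinset = Finset.filter (fun x => x ∈ T) Finset.univ := by ext; simp
  rw [e2]
  omega

theorem short_face (a b c : Perm α) (he : Nat.card α + 2 * nb (S3 a b c) ≤ FF a b c)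
    {x0 : α} (hx0 : ¬ (a x0 = b x0 ∧ a x0 = c x0)) :
    ∃ x, ¬ (a x = b x ∧ a x = c x) ∧
      ((a x = b x ∨ ∃ y, b x = a y ∧ b y = a x) ∨ (a x = c x ∨ ∃ y, c x = a y ∧ c y = a x) ∨
        (b x = c x ∨ ∃ y, c x = b y ∧ c y = b x)) := by
  by_contra hcon
  push Not at hcon
  set T : Set α := {x | a x = b x ∧ a x = c x}
  have gen : ∀ p q : Perm α, (∀ x ∈ T, p x = q x) →
      (∀ x, x ∉ T → p x ≠ q x ∧ ∀ y, q x = p y → q y ≠ p x) →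
      3 * cyc p q ≤ Nat.card α + 2 * T.ncard := by
    intro p q h1 h2
    apply count_cycles
    · intro x hx
      obtain ⟨h3, h4⟩ := h2 x hx
      constructor
      · intro h
        apply h3
        rw [Perm.mul_apply, Perm.inv_eq_iff_eq] at h
        exact h.symm
      · intro h
        refine h4 ((p⁻¹ * q) x) ?_ ?_
        · rw [Perm.mul_apply, aii]
        · rw [Perm.mul_apply, Perm.inv_eq_iff_eq] at h
          exact h
    · intro x hx
      rw [Perm.mul_apply, ← h1 x hx, iaa]
  have c1 := gen a b (fun x hx => hx.1) (fun x hx =>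
    (hcon x (fun h1 h2 => hx ⟨h1, h2⟩)).1)
  have c2 := gen a c (fun x hx => hx.2) (fun x hx =>
    (hcon x (fun h1 h2 => hx ⟨h1, h2⟩)).2.1)
  have c3 := gen b c (fun x hx => hx.1.symm.trans hx.2) (fun x hx =>
    (hcon x (fun h1 h2 => hx ⟨h1, h2⟩)).2.2)
  have hb : T.ncard + 1 ≤ nb (S3 a b c) := by
    classical
    -- trivial vertices are isolated bubbles
    let g : α ⊕ α → Option T := Sum.elim (fun x => if h : x ∈ T then some ⟨x, h⟩ else none)
      (fun y => if h : a⁻¹ y ∈ T then some ⟨a⁻¹ y, h⟩ else none)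
    have hga : ∀ x, g (Sum.inr (a x)) = g (Sum.inl x) := by
      intro x; simp only [g, Sum.elim_inl, Sum.elim_inr, iaa]
    have hgen : ∀ p : Perm α, (∀ x ∈ T, a x = p x) → G p ≤ Setoid.ker g := by
      intro p hp
      apply G_le
      intro x
      change g _ = g _
      by_cases hx : x ∈ T
      · rw [← hp x hx, hga]
      · have : a⁻¹ (p x) ∉ T := by
          intro h2
          have h3 := hp _ h2
          rw [aii] at h3
          have h4 := p.injective h3
          rw [← h4] at h2
          exact hx h2
        simp [g, hx]
        simpa using this
    have hle : S3 a b c ≤ Setoid.ker g :=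
      S3_le (hgen a (fun _ _ => rfl)) (hgen b (fun x hx => hx.1)) (hgen c (fun x hx => hx.2))
    have := Nat.card_le_card_of_surjective (Quotient.lift g (fun _ _ h => hle h)) (by
      intro o
      rcases o with _ | ⟨x, hx⟩
      · refine ⟨Quotient.mk _ (Sum.inl x0), ?_⟩
        have : x0 ∉ T := hx0
        simp [g, this]
      · refine ⟨Quotient.mk _ (Sum.inl x), ?_⟩
        simp [g, hx])
    rw [Finite.card_option] at this
    exact this
  unfold FF at he
  omega

theorem good_all (k : ℕ) : ∀ a b c a' b' c' s : Perm α, H Z Zb a b c a' b' c' →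
    {x | x ∉ Z ∧ x ∉ DD a b c s}.ncard ≤ k → Good a b c s := by
  induction k with
  | zero =>
    intro a b c a' b' c' s h hk
    have hD : ∀ x, x ∉ Z → x ∈ DD a b c s := by
      intro x hx
      by_contra hne
      have h0 : {x | x ∉ Z ∧ x ∉ DD a b c s} = ∅ := by
        rw [← Set.ncard_eq_zero (Set.toFinite _)]; omega
      have : x ∈ {x | x ∉ Z ∧ x ∉ DD a b c s} := ⟨hx, hne⟩
      rw [h0] at this
      exact this
    have hle : G s ≤ S3 a b c := by
      apply G_le
      intro x
      by_cases hx : x ∈ Z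
      · have hy : a⁻¹ (s x) ∈ Z := by
          by_contra hy
          have h1 := (hD _ hy).2.2
          rw [aii] at h1
          have := s.injective h1
          rw [← this] at hy
          exact hy hx
        have h1 := h.conn x hx _ hy
        have h2 : S3 a b c (Sum.inl x) (Sum.inl (a⁻¹ (s x))) :=
          (sup_le_sup (sup_le_sup (GZ_le Z a) (GZ_le Z b)) (GZ_le Z c) :
            GZ Z a ⊔ GZ Z b ⊔ GZ Z c ≤ S3 a b c) h1
        have h3 := rel_of_G_le (le1 a b c) (a⁻¹ (s x))
        rw [aii] at h3
        exact Setoid.trans' _ h2 h3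
      · rw [← (hD x hx).2.2]
        exact rel_of_G_le (le1 a b c) x
    refine ⟨s, hle, ?_⟩
    rw [sup_eq_left.mpr hle]
  | succ k ihk =>
    intro a b c a' b' c' s h hk
    have ih : IHt Z Zb (DD a b c s) := by
      intro a2 b2 c2 a2' b2' c2' s2 h2 hsub ⟨v, hv1, hv2, hv3⟩
      apply ihk _ _ _ _ _ _ _ h2
      have : {x | x ∉ Z ∧ x ∉ DD a2 b2 c2 s2}.ncard < {x | x ∉ Z ∧ x ∉ DD a b c s}.ncard := by
        apply Set.ncard_lt_ncard _ (Set.toFinite _)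
        refine ⟨fun x hx => ⟨hx.1, fun hh => hx.2 (hsub hh)⟩, fun hss => ?_⟩
        exact (hss ⟨hv1, hv2⟩).2 hv3
      omega
    by_cases hN : ∃ x0, ¬ (a' x0 = b' x0 ∧ a' x0 = c' x0)
    · obtain ⟨x0, hx0⟩ := hN
      obtain ⟨x, hx, hf⟩ := short_face a' b' c' h.eul hx0
      have hxZ : x ∉ Z := fun hh => hx ⟨h.tab x hh, h.tac x hh⟩
      rw [h.ea x hxZ, h.eb x hxZ, h.ec x hxZ] at hx hf
      have hnY : ∀ p p' q : Perm α, (∀ x, q x ∈ Zb ↔ x ∈ Z) → (∀ x, p x ∈ Zb ↔ x ∈ Z) →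
          (∀ x, x ∉ Z → p' x = p x) → (∀ x, x ∈ Z → p' x ∈ Zb) → ∀ y, q x = p' y → y ∉ Z := by
        intro p p' q hq hp hpp hpz y hy hyZ
        have := hpz y hyZ
        rw [← hy, hq] at this
        exact hxZ this
      -- the primed permutations also send `Z` into `Zb`
      have hpz : ∀ p p' : Perm α, (∀ x, p x ∈ Zb ↔ x ∈ Z) → (∀ x, x ∉ Z → p' x = p x) →
          ∀ x, x ∈ Z → p' x ∈ Zb := by
        intro p p' hp hpp x hx
        have : p⁻¹ (p' x) ∈ Z := by
          by_contra hn
          have h1 := hpp _ hn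
          rw [aii] at h1
          have h2 := p'.injective h1
          rw [h2] at hn
          exact hn hx
        rw [← hp, aii] at this
        exact this
      have ya := fun q hq => hnY a a' q hq h.za h.ea (hpz a a' h.za h.ea)
      have yb := fun q hq => hnY b b' q hq h.zb h.eb (hpz b b' h.zb h.eb)
      rcases hf with hf | hf | hf
      · refine stepFace h ih hxZ hx (hf.imp id ?_)
        rintro ⟨y, h1, h2⟩
        have hy := ya b h.zb y h1
        exact ⟨y, by rw [h1, h.ea y hy], by rw [← h2, h.eb y hy]⟩
      · apply Good.comm23
        rw [DD_comm23] at ih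
        refine stepFace h.comm23 ih hxZ (fun hh => hx hh.symm) (hf.imp id ?_)
        rintro ⟨y, h1, h2⟩
        have hy := ya c h.zc y h1
        exact ⟨y, by rw [h1, h.ea y hy], by rw [← h2, h.ec y hy]⟩
      · apply Good.comm12
        apply Good.comm23
        rw [DD_comm12, DD_comm23] at ih
        refine stepFace h.comm12.comm23 ih hxZ
          (fun hh => hx ⟨hh.2.symm, hh.2.symm.trans hh.1⟩) (hf.imp id ?_)
        rintro ⟨y, h1, h2⟩
        have hy := yb c h.zc y h1
        exact ⟨y, by rw [h1, h.eb y hy], by rw [← h2, h.ec y hy]⟩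
    · push Not at hN
      by_cases hD : ∃ v, v ∉ Z ∧ v ∉ DD a b c s
      · obtain ⟨v, hv, hvD⟩ := hD
        have hN' := hN v
        rw [h.ea v hv, h.eb v hv, h.ec v hv] at hN'
        have hsv : s v ≠ a v := fun hh => hvD ⟨hN'.1, hN'.2, hh.symm⟩
        apply Good.of_le _ (sw1 (v := v) rfl hsv (Or.inl (same_par hN'.1.symm)))
        exact contract h rfl hv (par_apply _ _ _) (DD_par_last rfl) hvD ih
      · push Not at hD
        apply ihk _ _ _ _ _ _ _ h
        have h0 : {x | x ∉ Z ∧ x ∉ DD a b c s} = ∅ := by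
          ext x; simp only [Set.mem_ofPred_eq, Set.mem_empty_iff_false, iff_false]
          exact fun hh => hh.2 (hD x hh.1)
        rw [h0]; simp

theorem good_of_H {s : Perm α} (h : H Z Zb a b c a' b' c') : Good a b c s :=
  good_all _ _ _ _ _ _ _ s h le_rfl

end induct

section final
variable {α : Type*} [Finite α] [DecidableEq α]

theorem orb_iff {ι : Type*} (s : ι → Perm α) (i0 : ι) (x y : α) :
    (⨆ i, G (s i)) (Sum.inl x) (Sum.inl y) ↔
      ∃ g ∈ Subgroup.closure {g : Perm α | ∃ a b : ι, g = (s a)⁻¹ * s b}, g x = y := by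
  set K := Subgroup.closure {g : Perm α | ∃ a b : ι, g = (s a)⁻¹ * s b} with hK
  constructor
  · let r : Setoid α := ⟨fun x y => ∃ g ∈ K, g x = y,
      fun x => ⟨1, K.one_mem, rfl⟩,
      fun {x y} ⟨g, hg, h⟩ => ⟨g⁻¹, K.inv_mem hg, by rw [← h, iaa]⟩,
      fun {x y z} ⟨g, hg, h⟩ ⟨g', hg', h'⟩ =>
        ⟨g' * g, K.mul_mem hg' hg, by rw [Perm.mul_apply, h, h']⟩⟩
    let f : α ⊕ α → α := Sum.elim id (fun y => (s i0)⁻¹ y)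
    have hle : (⨆ i, G (s i)) ≤ Setoid.comap f r := by
      apply iSup_le
      intro i
      apply G_le
      intro x
      exact ⟨(s i0)⁻¹ * s i, Subgroup.subset_closure ⟨i0, i, rfl⟩, rfl⟩
    intro h
    exact hle h
  · rintro ⟨g, hg, rfl⟩
    revert x
    refine Subgroup.closure_induction (p := fun g _ => ∀ x,
      (⨆ i, G (s i)) (Sum.inl x) (Sum.inl (g x))) ?_ ?_ ?_ ?_ hg
    · rintro g ⟨i, j, rfl⟩ x
      have h1 := rel_of_G_le (le_iSup (fun i => G (s i)) j) x
      have h2 := rel_of_G_le (le_iSup (fun i => G (s i)) i) (((s i)⁻¹ * s j) x)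
      rw [Perm.mul_apply, aii] at h2
      exact Setoid.trans' _ h1 (Setoid.symm' _ h2)
    · intro x; exact Setoid.refl' _ _
    · intro g g' _ _ h1 h2 x
      exact Setoid.trans' _ (h2 x) (h1 (g' x))
    · intro g _ h1 x
      have := h1 (g⁻¹ x)
      rw [aii] at this
      exact Setoid.symm' _ this

theorem S3_eq_iSup (t : Fin 3 → Perm α) : S3 (t 0) (t 1) (t 2) = ⨆ i, G (t i) := by
  apply le_antisymm
  · exact S3_le (le_iSup (fun i => G (t i)) 0) (le_iSup (fun i => G (t i)) 1)
      (le_iSup (fun i => G (t i)) 2)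
  · apply iSup_le
    intro i
    fin_cases i
    · exact le1 _ _ _
    · exact le2 _ _ _
    · exact le3 _ _ _

theorem S4_eq_iSup {n : ℕ} (s : Perm (Fin n)) (t : Fin 3 → Perm (Fin n)) :
    S3 (t 0) (t 1) (t 2) ⊔ G s = ⨆ i, G (withZero s t i) := by
  apply le_antisymm
  · apply sup_le
    · exact S3_le (le_iSup (fun i => G (withZero s t i)) 1)
        (le_iSup (fun i => G (withZero s t i)) 2) (le_iSup (fun i => G (withZero s t i)) 3)
    · exact le_iSup (fun i => G (withZero s t i)) 0
  · apply iSup_le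
    intro i
    fin_cases i
    · exact le_sup_right
    · exact (le1 _ _ _).trans le_sup_left
    · exact (le2 _ _ _).trans le_sup_left
    · exact (le3 _ _ _).trans le_sup_left

theorem connected_iff {n : ℕ} (s : Perm (Fin n)) (t : Fin 3 → Perm (Fin n)) :
    ColoredConnected (withZero s t) ↔
      ∀ x y, (S3 (t 0) (t 1) (t 2) ⊔ G s) (Sum.inl x) (Sum.inl y) := by
  rw [S4_eq_iSup]
  unfold ColoredConnected
  simp only [orb_iff (withZero s t) 0]

theorem nc_sum {ι : Type*} [Fintype ι] (f : Perm α) (W : ι → Set α)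
    (hcov : ∀ x, ∃ j, x ∈ W j) (hdisj : ∀ x i j, x ∈ W i → x ∈ W j → i = j)
    (fj : ∀ j, Perm (W j)) (h : ∀ j x, (fj j x : α) = f x) :
    numCycles f = ∑ j, numCycles (fj j) := by
  have hpow : ∀ j (k : ℕ) (x : W j), (((fj j) ^ k) x : α) = (f ^ k) x := by
    intro j k x
    induction k with
    | zero => rfl
    | succ k ih => rw [pow_succ', Perm.mul_apply, h, ih, pow_succ', Perm.mul_apply]
  have hsame : ∀ j (x y : W j), (fj j).SameCycle x y ↔ f.SameCycle x y := by
    intro j x y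
    constructor
    · intro hh
      obtain ⟨k, hk⟩ := hh.exists_nat_pow_eq
      exact ⟨k, by rw [zpow_natCast, ← hpow, hk]⟩
    · intro hh
      obtain ⟨k, hk⟩ := hh.exists_nat_pow_eq
      exact ⟨k, by rw [zpow_natCast]; apply Subtype.ext; rw [hpow, hk]⟩
  unfold numCycles
  rw [← Nat.card_sigma]
  symm
  apply Nat.card_eq_of_bijective (fun p : (Σ j, Quotient (permSetoid (fj j))) =>
    Quotient.map' (s₁ := permSetoid (fj p.1)) (s₂ := permSetoid f) (fun x => (x : α))
      (fun x y hxy => (hsame p.1 x y).1 hxy) p.2)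
  constructor
  · rintro ⟨i, p⟩ ⟨j, q⟩ hpq
    induction p using Quotient.inductionOn with
    | h x =>
    induction q using Quotient.inductionOn with
    | h y =>
    have hxy : f.SameCycle x y := Quotient.exact hpq
    have hy : (y : α) ∈ W i := by
      obtain ⟨k, hk⟩ := hxy.exists_nat_pow_eq
      rw [← hk, ← hpow]
      exact Subtype.property _
    have hij : i = j := hdisj _ _ _ hy y.2
    subst hij
    congr 1
    exact Quotient.sound ((hsame i x y).2 hxy)
  · intro q
    induction q using Quotient.inductionOn with
    | h x =>
    obtain ⟨j, hj⟩ := hcov x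
    exact ⟨⟨j, Quotient.mk _ ⟨x, hj⟩⟩, rfl⟩

/-- connecting the components by swaps -/
theorem exists_connected (a b c : Perm α) (k : ℕ) : ∀ s : Perm α,
    nb (S3 a b c ⊔ G s) ≤ k + 1 → ∃ s' : Perm α,
      (∀ x y, (S3 a b c ⊔ G s') (Sum.inl x) (Sum.inl y)) ∧ CC a b c s ≤ CC a b c s' + 3 * k := by
  induction k with
  | zero =>
    intro s hs
    refine ⟨s, ?_, by omega⟩
    intro x y
    have : Subsingleton (Quotient (S3 a b c ⊔ G s)) := by
      apply Finite.card_le_one_iff_subsingleton.mp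
      simpa [nb] using hs
    exact Quotient.exact (Subsingleton.elim (Quotient.mk (S3 a b c ⊔ G s) (Sum.inl x))
      (Quotient.mk _ (Sum.inl y)))
  | succ k ih =>
    intro s hs
    by_cases hc : ∀ x y, (S3 a b c ⊔ G s) (Sum.inl x) (Sum.inl y)
    · exact ⟨s, hc, by omega⟩
    push Not at hc
    obtain ⟨x, y, hxy⟩ := hc
    have ns : ∀ p : Perm α, G p ≤ S3 a b c → ¬ (p⁻¹ * s).SameCycle x y := fun p hp hh =>
      hxy (rel_of_sameCycle (hp.trans le_sup_left) le_sup_right hh)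
    have h1 := cyc_swap_merge (ns a (le1 _ _ _))
    have h2 := cyc_swap_merge (ns b (le2 _ _ _))
    have h3 := cyc_swap_merge (ns c (le3 _ _ _))
    have h4 := nb_swap_le_of_merge (S3 a b c) (le1 _ _ _) (ns a (le1 _ _ _))
    have h5 : (S3 a b c ⊔ G (s * swap x y)) (Sum.inl x) (Sum.inl y) :=
      rel_of_sameCycle ((le1 a b c).trans le_sup_left) le_sup_right
        (cyc_merge_same (ns a (le1 _ _ _)))
    have h6 := nb_lt_of_le h4 h5 hxy
    obtain ⟨s', h7, h8⟩ := ih (s * swap x y) (by omega)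
    refine ⟨s', h7, ?_⟩
    unfold CC at *
    omega

theorem exists_triv {Z Zb : Set α} {a p : Perm α} (za : ∀ x, a x ∈ Zb ↔ x ∈ Z)
    (zp : ∀ x, p x ∈ Zb ↔ x ∈ Z) :
    ∃ p' : Perm α, (∀ x, x ∉ Z → p' x = p x) ∧ ∀ x, x ∈ Z → a x = p' x := by
  classical
  have hpres : ∀ x, (a⁻¹ * p) x ∉ Z ↔ x ∉ Z := by
    intro x
    rw [← za, Perm.mul_apply, aii, zp]
  refine ⟨a * Perm.ofSubtype (Perm.subtypePerm (p := fun x => x ∉ Z) (a⁻¹ * p) hpres), ?_, ?_⟩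
  · intro x hx
    rw [Perm.mul_apply, Perm.ofSubtype_apply_of_mem (p := fun x => x ∉ Z) _ hx]
    simp
  · intro x hx
    rw [Perm.mul_apply, Perm.ofSubtype_apply_of_not_mem (p := fun x => x ∉ Z) _ (not_not.2 hx)]

end final

section assemble
variable {n m : ℕ}

theorem cycles_lower {f f' : Perm (Fin n)} {W : Fin (m + 1) → Set (Fin n)}
    (hdisj : ∀ x i j, x ∈ W i → x ∈ W j → i = j)
    (h0 : ∀ x, x ∈ W 0 → f' x = x) (h1 : ∀ x, x ∉ W 0 → f' x = f x) :
    (W 0).ncard + ∑ j : Fin m, orbitsIn f (W j.succ) ≤ numCycles f' := by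
  have hle : permSetoid f' ≤ permSetoid f := by
    apply permSetoid_le_of
    intro z
    by_cases hz : z ∈ W 0
    · rw [h0 z hz]
    · rw [h1 z hz]; exact sameCycle_step f z
  have hmem : ∀ (j : Fin m) (q : {q : Quotient (permSetoid f) //
      ∀ x : Fin n, Quotient.mk (permSetoid f) x = q → x ∈ W j.succ}), q.1.out ∈ W j.succ :=
    fun j q => q.2 _ (Quotient.out_eq _)
  let F : (W 0) ⊕ (Σ j : Fin m, {q : Quotient (permSetoid f) //
      ∀ x : Fin n, Quotient.mk (permSetoid f) x = q → x ∈ W j.succ}) →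
      Quotient (permSetoid f') :=
    Sum.elim (fun z => Quotient.mk _ (z : Fin n)) (fun p => Quotient.mk _ p.2.1.out)
  have hfix : ∀ z y, z ∈ W 0 → f'.SameCycle z y → y = z := by
    intro z y hz hh
    exact mem_of_sameCycle (A := {u | u = z}) (fun u (hu : u = z) => by
      change f' u = z
      rw [hu, h0 z hz]) hh rfl
  have hF : Function.Injective F := by
    rintro (⟨z, hz⟩ | ⟨i, p⟩) (⟨y, hy⟩ | ⟨j, q⟩) hh
    · have h2 : f'.SameCycle z y := Quotient.exact hh
      have := hfix z y hz h2
      subst this; rfl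
    · exfalso
      have h2 : f'.SameCycle z q.1.out := Quotient.exact hh
      have h3 := hfix z _ hz h2
      have h4 := hmem j q
      rw [h3] at h4
      exact absurd (hdisj _ _ _ hz h4) (Fin.succ_ne_zero j).symm
    · exfalso
      have h2 : f'.SameCycle p.1.out y := Quotient.exact hh
      have h3 := hfix y _ hy h2.symm
      have h4 := hmem i p
      rw [h3] at h4
      exact absurd (hdisj _ _ _ hy h4) (Fin.succ_ne_zero i).symm
    · have h2 : permSetoid f' p.1.out q.1.out := Quotient.exact hh
      have h3 : p.1 = q.1 := by
        have := Quotient.sound (s := permSetoid f) (hle h2)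
        rwa [Quotient.out_eq, Quotient.out_eq] at this
      have h4 := hmem i p
      rw [h3] at h4
      have h5 := Fin.succ_injective _ (hdisj _ _ _ h4 (hmem j q))
      subst h5
      have : p = q := Subtype.ext h3
      subst this
      rfl
  have := Nat.card_le_card_of_injective F hF
  rw [Nat.card_sum, Nat.card_sigma] at this
  exact this

theorem build_H (τ : Fin 3 → Perm (Fin n)) (W : Fin (m + 1) → Set (Fin n))
    (hcover : ∀ x : Fin n, ∃ j, x ∈ W j)
    (hdisj : ∀ x i j, x ∈ W i → x ∈ W j → i = j)
    (hne : ∀ j, ∃ x, x ∈ W j)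
    (hS : ∀ j x y, x ∈ W j → (S3 (τ 0) (τ 1) (τ 2) (Sum.inl x) (Sum.inl y) ↔ y ∈ W j))
    (hplanar : ∀ j, j ≠ 0 →
      orbitsIn ((τ 0)⁻¹ * τ 1) (W j) + orbitsIn ((τ 0)⁻¹ * τ 2) (W j) +
        orbitsIn ((τ 1)⁻¹ * τ 2) (W j) = (W j).ncard + 2) :
    ∃ b' c', H (W 0) (⇑(τ 0) '' W 0) (τ 0) (τ 1) (τ 2) (τ 0) b' c' := by
  classical
  set S := S3 (τ 0) (τ 1) (τ 2) with hSdef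
  have hG : ∀ i, G (τ i) ≤ S := by
    intro i
    rw [hSdef, S3_eq_iSup]
    exact le_iSup (fun i => G (τ i)) i
  have hz : ∀ i x, τ i x ∈ ⇑(τ 0) '' W 0 ↔ x ∈ W 0 := by
    intro i x
    have key : S (Sum.inl x) (Sum.inl ((τ 0)⁻¹ (τ i x))) := by
      have h1 := rel_of_G_le (hG i) x
      have h2 := rel_of_G_le (hG 0) ((τ 0)⁻¹ (τ i x))
      rw [aii] at h2
      exact S.trans' h1 (S.symm' h2)
    constructor
    · rintro ⟨y, hy, hyx⟩
      rw [← hyx, iaa] at key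
      exact (hS 0 y x hy).1 (S.symm' key)
    · intro hx
      exact ⟨_, (hS 0 _ _ hx).1 key, aii _ _⟩
  obtain ⟨b', hb1, hb2⟩ := exists_triv (hz 0) (hz 1)
  obtain ⟨c', hc1, hc2⟩ := exists_triv (hz 0) (hz 2)
  refine ⟨b', c', hz 0, hz 1, hz 2, fun _ _ => rfl, hb1, hc1, hb2, hc2, ?_, ?_⟩
  · -- connectivity inside of the distinguished bubble
    set R := GZ (W 0) (τ 0) ⊔ GZ (W 0) (τ 1) ⊔ GZ (W 0) (τ 2) with hR
    let g : Fin n ⊕ Fin n → Option (Quotient R) :=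
      Sum.elim (fun x => if x ∈ W 0 then some (Quotient.mk R (Sum.inl x)) else none)
        (fun y => if y ∈ ⇑(τ 0) '' W 0 then some (Quotient.mk R (Sum.inr y)) else none)
    have hgen : ∀ i, GZ (W 0) (τ i) ≤ R → G (τ i) ≤ Setoid.ker g := by
      intro i hi
      apply G_le
      intro x
      change g _ = g _
      simp only [g, Sum.elim_inl, Sum.elim_inr, hz]
      split_ifs with hx
      · congr 1
        apply Quotient.sound
        exact hi (Relation.EqvGen.rel _ _ ⟨x, hx, rfl, rfl⟩)
      · rfl
    have hle : S ≤ Setoid.ker g := S3_le (hgen 0 (le_sup_left.trans le_sup_left))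
      (hgen 1 (le_sup_right.trans le_sup_left)) (hgen 2 le_sup_right)
    intro x hx y hy
    have h1 : g _ = g _ := hle ((hS 0 x y hx).2 hy)
    simp only [g, Sum.elim_inl, hx, hy, if_true] at h1
    exact Quotient.exact (Option.some.inj h1)
  · have hcard : n = ∑ j, (W j).ncard := by
      have h1 := nc_sum (1 : Perm (Fin n)) W hcover hdisj (fun j => 1) (fun _ _ => rfl)
      have h2 : ∀ β : Type, [Finite β] → numCycles (1 : Perm β) = Nat.card β := by
        intro β _
        classical
        have := cyc_self (1 : Perm β)
        rwa [cyc, inv_one, one_mul] at this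
      rw [h2, Nat.card_fin] at h1
      refine h1.trans ?_
      apply Finset.sum_congr rfl
      intro j _
      rw [h2]
      rfl
    rw [Fin.sum_univ_succ] at hcard
    have hpl : ∑ j : Fin m, (orbitsIn ((τ 0)⁻¹ * τ 1) (W j.succ) +
        orbitsIn ((τ 0)⁻¹ * τ 2) (W j.succ) + orbitsIn ((τ 1)⁻¹ * τ 2) (W j.succ)) =
        ∑ j : Fin m, ((W j.succ).ncard + 2) :=
      Finset.sum_congr rfl (fun j _ => hplanar _ (Fin.succ_ne_zero j))
    simp only [Finset.sum_add_distrib, Finset.sum_const, Finset.card_univ, Fintype.card_fin,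
      smul_eq_mul] at hpl
    have c1 := cycles_lower (f := (τ 0)⁻¹ * τ 1) (f' := (τ 0)⁻¹ * b') hdisj
      (fun x hx => by rw [Perm.mul_apply, ← hb2 x hx, iaa])
      (fun x hx => by rw [Perm.mul_apply, hb1 x hx, Perm.mul_apply])
    have c2 := cycles_lower (f := (τ 0)⁻¹ * τ 2) (f' := (τ 0)⁻¹ * c') hdisj
      (fun x hx => by rw [Perm.mul_apply, ← hc2 x hx, iaa])
      (fun x hx => by rw [Perm.mul_apply, hc1 x hx, Perm.mul_apply])
    have c3 := cycles_lower (f := (τ 1)⁻¹ * τ 2) (f' := b'⁻¹ * c') hdisj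
      (fun x hx => by rw [Perm.mul_apply, ← hc2 x hx, hb2 x hx, iaa])
      (fun x hx => by
        have hy : (τ 1)⁻¹ (τ 2 x) ∉ W 0 := by
          rw [← hz 1, aii, hz 2]; exact hx
        rw [Perm.mul_apply, hc1 x hx, Perm.mul_apply, Perm.inv_eq_iff_eq, hb1 _ hy, aii])
    -- number of bubbles
    have hnb : nb (S3 (τ 0) b' c') ≤ (W 0).ncard + m := by
      set S' := S3 (τ 0) b' c' with hS'
      choose rep hrep using hne
      let g : Fin n ⊕ Fin n → Option (Quotient S') :=
        Sum.elim (fun x => if x ∈ W 0 then none else some (Quotient.mk S' (Sum.inl x)))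
          (fun y => if y ∈ ⇑(τ 0) '' W 0 then none else some (Quotient.mk S' (Sum.inr y)))
      have hgen : ∀ i p, (∀ x, x ∉ W 0 → p x = τ i x) → G p ≤ S' → G (τ i) ≤ Setoid.ker g := by
        intro i p hp hi
        apply G_le
        intro x
        change g _ = g _
        simp only [g, Sum.elim_inl, Sum.elim_inr, hz]
        split_ifs with hx
        · rfl
        · congr 1
          apply Quotient.sound
          rw [← hp x hx]
          exact rel_of_G_le hi x
      have hle : S ≤ Setoid.ker g := S3_le (hgen 0 (τ 0) (fun _ _ => rfl) (le1 _ _ _))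
        (hgen 1 b' hb1 (le2 _ _ _)) (hgen 2 c' hc1 (le3 _ _ _))
      let F : (W 0) ⊕ Fin m → Quotient S' :=
        Sum.elim (fun z => Quotient.mk S' (Sum.inl (z : Fin n)))
          (fun j => Quotient.mk S' (Sum.inl (rep j.succ)))
      have hF0 : ∀ x, ∃ u, F u = Quotient.mk S' (Sum.inl x) := by
        intro x
        by_cases hx : x ∈ W 0
        · exact ⟨Sum.inl ⟨x, hx⟩, rfl⟩
        · obtain ⟨j, hj⟩ := hcover x
          rcases Fin.eq_zero_or_eq_succ j with rfl | ⟨i, rfl⟩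
          · exact absurd hj hx
          · refine ⟨Sum.inr i, ?_⟩
            have hr : rep i.succ ∉ W 0 := fun hh =>
              absurd (hdisj _ _ _ hh (hrep i.succ)) (Fin.succ_ne_zero i).symm
            have h1 : g _ = g _ := hle ((hS _ _ _ (hrep i.succ)).2 hj)
            simp only [g, Sum.elim_inl, hx, hr, if_false] at h1
            exact Option.some.inj h1
      have hF : Function.Surjective F := by
        intro q
        induction q using Quotient.inductionOn with
        | h u =>
        rcases u with x | y
        · exact hF0 x
        · obtain ⟨u, hu⟩ := hF0 ((τ 0)⁻¹ y)
          refine ⟨u, hu.trans ?_⟩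
          apply Quotient.sound
          have := rel_of_G_le (le1 (τ 0) b' c') ((τ 0)⁻¹ y)
          rw [aii] at this
          exact this
      have := Nat.card_le_card_of_surjective F hF
      rw [Nat.card_sum, Nat.card_fin] at this
      exact this
    rw [Nat.card_fin]
    unfold FF cyc
    omega

theorem nb_bubbles (τ : Fin 3 → Perm (Fin n)) (W : Fin (m + 1) → Set (Fin n))
    (hcover : ∀ x : Fin n, ∃ j, x ∈ W j)
    (hdisj : ∀ x i j, x ∈ W i → x ∈ W j → i = j)
    (hne : ∀ j, ∃ x, x ∈ W j)
    (hS : ∀ j x y, x ∈ W j → (S3 (τ 0) (τ 1) (τ 2) (Sum.inl x) (Sum.inl y) ↔ y ∈ W j)) :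
    nb (S3 (τ 0) (τ 1) (τ 2)) = m + 1 := by
  choose rep hrep using hne
  have hb : Function.Bijective
      (fun j => Quotient.mk (S3 (τ 0) (τ 1) (τ 2)) (Sum.inl (rep j))) := by
    constructor
    · intro i j hij
      have := (hS i _ _ (hrep i)).1 (Quotient.exact hij)
      exact hdisj _ _ _ this (hrep j)
    · have h0 : ∀ x, ∃ j, Quotient.mk (S3 (τ 0) (τ 1) (τ 2)) (Sum.inl (rep j)) =
          Quotient.mk _ (Sum.inl x) := by
        intro x
        obtain ⟨j, hj⟩ := hcover x
        exact ⟨j, Quotient.sound ((hS j _ _ (hrep j)).2 hj)⟩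
      intro q
      induction q using Quotient.inductionOn with
      | h u =>
      rcases u with x | y
      · exact h0 x
      · obtain ⟨u, hu⟩ := h0 ((τ 0)⁻¹ y)
        refine ⟨u, hu.trans ?_⟩
        apply Quotient.sound
        have := rel_of_G_le (le1 (τ 0) (τ 1) (τ 2)) ((τ 0)⁻¹ y)
        rw [aii] at this
        exact this
  have := Nat.card_eq_of_bijective _ hb
  rw [Nat.card_fin] at this
  exact this.symm

theorem CC_eq_sum (τ : Fin 3 → Perm (Fin n)) (W : Fin (m + 1) → Set (Fin n))
    (hcover : ∀ x : Fin n, ∃ j, x ∈ W j)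
    (hdisj : ∀ x i j, x ∈ W i → x ∈ W j → i = j)
    (r : (j : Fin (m + 1)) → Fin 3 → (W j ≃ (⇑(τ 0) '' W j : Set (Fin n))))
    (hr : ∀ j i (x : W j), (r j i x : Fin n) = τ i (x : Fin n))
    (p : Perm (Fin n)) (π : ∀ j, W j ≃ (⇑(τ 0) '' W j : Set (Fin n)))
    (hp : ∀ j (x : W j), (π j x : Fin n) = p x) :
    CC (τ 0) (τ 1) (τ 2) p = ∑ j, ∑ i : Fin 3, numCycles ((π j).trans (r j i).symm) := by
  have h1 : ∀ i, cyc (τ i) p = ∑ j, numCycles ((π j).trans (r j i).symm) := by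
    intro i
    apply nc_sum _ W hcover hdisj
    intro j x
    rw [Perm.mul_apply, eq_comm, Perm.inv_eq_iff_eq, ← hr, ← hp]
    simp
  rw [Finset.sum_comm, Fin.sum_univ_three, ← h1, ← h1, ← h1]
  rfl

end assemble

end MCB

/-- **Maximal number of bicolored cycles when all bubbles but one are planar** (d = 3): if the
bubbles `W 0, W 1, …, W m` of `(τ 0, τ 1, τ 2)` are such that the restricted bubbles on
`W j`, `j ≥ 1`, are planar, and `M j` denotes the maximal number `C_1(B_j)` of bicolored cycles
of a pairing of the restricted bubble on `W j`, then the maximum of `C_0` over all permutations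
`σ₀` making the colored graph connected equals `M 0 + Σ_{j=1}^m (M j − 3)`, i.e. the value `K`
with `K + 3·m = Σ_j M j`. -/
theorem max_cycles_all_planar_but_one {n m : ℕ} (τ : Fin 3 → Equiv.Perm (Fin n))
    (W : Fin (m + 1) → Set (Fin n))
    (horb : ∀ j, ∃ w : Fin n, W j = MulAction.orbit (bubbleSubgroup τ) w)
    (hinj : Function.Injective W)
    (hcover : ∀ x : Fin n, ∃ j, x ∈ W j)
    (r : (j : Fin (m + 1)) → Fin 3 → (W j ≃ (⇑(τ 0) '' W j : Set (Fin n))))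
    (hr : ∀ j i (x : W j), (r j i x : Fin n) = τ i (x : Fin n))
    (hplanar : ∀ j, j ≠ 0 →
      orbitsIn ((τ 0)⁻¹ * τ 1) (W j) + orbitsIn ((τ 0)⁻¹ * τ 2) (W j) +
        orbitsIn ((τ 1)⁻¹ * τ 2) (W j) = (W j).ncard + 2)
    (M : Fin (m + 1) → ℕ)
    (hM : ∀ j, (∃ π : W j ≃ (⇑(τ 0) '' W j : Set (Fin n)),
        (∑ i : Fin 3, numCycles (π.trans (r j i).symm)) = M j) ∧
      ∀ π : W j ≃ (⇑(τ 0) '' W j : Set (Fin n)),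
        (∑ i : Fin 3, numCycles (π.trans (r j i).symm)) ≤ M j) :
    ∃ K : ℕ, K + 3 * m = ∑ j, M j ∧
      (∃ σ₀ : Equiv.Perm (Fin n), ColoredConnected (withZero σ₀ τ) ∧
        C0 (withZero σ₀ τ) = K) ∧
      ∀ σ₀ : Equiv.Perm (Fin n), ColoredConnected (withZero σ₀ τ) →
        C0 (withZero σ₀ τ) ≤ K := by

  classical
  have hS0 : ∀ x y, MCB.S3 (τ 0) (τ 1) (τ 2) (Sum.inl x) (Sum.inl y) ↔
      ∃ g ∈ bubbleSubgroup τ, g x = y := by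
    intro x y
    rw [MCB.S3_eq_iSup]
    exact MCB.orb_iff τ 0 x y
  have hmemorb : ∀ w y, y ∈ MulAction.orbit (bubbleSubgroup τ) w ↔
      MCB.S3 (τ 0) (τ 1) (τ 2) (Sum.inl w) (Sum.inl y) := by
    intro w y
    rw [hS0]
    constructor
    · rintro ⟨g, hg⟩; exact ⟨g.1, g.2, hg⟩
    · rintro ⟨g, hg, h⟩; exact ⟨⟨g, hg⟩, h⟩
  have hS : ∀ j x y, x ∈ W j →
      (MCB.S3 (τ 0) (τ 1) (τ 2) (Sum.inl x) (Sum.inl y) ↔ y ∈ W j) := by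
    intro j x y hx
    obtain ⟨w, hw⟩ := horb j
    rw [hw, hmemorb] at hx
    rw [hw, hmemorb]
    exact ⟨fun h => Setoid.trans' _ hx h, fun h => Setoid.trans' _ (Setoid.symm' _ hx) h⟩
  have hdisj : ∀ x i j, x ∈ W i → x ∈ W j → i = j := by
    intro x i j hi hj
    apply hinj
    ext y
    rw [← hS i x y hi, ← hS j x y hj]
  have hne : ∀ j, ∃ x, x ∈ W j := by
    intro j
    obtain ⟨w, hw⟩ := horb j
    exact ⟨w, by rw [hw]; exact MulAction.mem_orbit_self w⟩
  have hnb := MCB.nb_bubbles τ W hcover hdisj hne hS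
  obtain ⟨b', c', hH⟩ := MCB.build_H τ W hcover hdisj hne hS hplanar
  have hC0 : ∀ s, C0 (withZero s τ) = MCB.CC (τ 0) (τ 1) (τ 2) s := fun s => rfl
  -- upper bound
  have upper : ∀ s : Equiv.Perm (Fin n), ColoredConnected (withZero s τ) →
      C0 (withZero s τ) + 3 * m ≤ ∑ j, M j := by
    intro s hs
    rw [MCB.connected_iff] at hs
    obtain ⟨p, hp1, hp2⟩ := MCB.good_of_H (s := s) hH
    have h1 : MCB.nb (MCB.S3 (τ 0) (τ 1) (τ 2) ⊔ MCB.G s) ≤ 1 := by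
      apply Finite.card_le_one_iff_subsingleton.mpr
      have hw : ∀ u : Fin n ⊕ Fin n, ∃ x,
          (MCB.S3 (τ 0) (τ 1) (τ 2) ⊔ MCB.G s) u (Sum.inl x) := by
        rintro (x | y)
        · exact ⟨x, Setoid.refl' _ _⟩
        · refine ⟨s⁻¹ y, Setoid.symm' _ ?_⟩
          have := MCB.rel_of_G_le
            (le_sup_right : MCB.G s ≤ MCB.S3 (τ 0) (τ 1) (τ 2) ⊔ MCB.G s) (s⁻¹ y)
          rwa [MCB.aii] at this
      constructor
      intro q1 q2
      induction q1 using Quotient.inductionOn with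
      | h u =>
      induction q2 using Quotient.inductionOn with
      | h v =>
      obtain ⟨x, hx⟩ := hw u
      obtain ⟨y, hy⟩ := hw v
      exact Quotient.sound
        (Setoid.trans' _ hx (Setoid.trans' _ (hs x y) (Setoid.symm' _ hy)))
    have hpm : ∀ j (x : W j), p x ∈ (⇑(τ 0) '' W j : Set (Fin n)) := by
      intro j x
      refine ⟨(τ 0)⁻¹ (p x), ?_, MCB.aii _ _⟩
      rw [← hS j x _ x.2]
      have e1 := MCB.rel_of_G_le hp1 (x : Fin n)
      have e2 := MCB.rel_of_G_le (MCB.le1 (τ 0) (τ 1) (τ 2)) ((τ 0)⁻¹ (p x))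
      rw [MCB.aii] at e2
      exact Setoid.trans' _ e1 (Setoid.symm' _ e2)
    let π : ∀ j, W j ≃ (⇑(τ 0) '' W j : Set (Fin n)) := fun j =>
      Equiv.ofBijective (fun x => ⟨p x, hpm j x⟩) (by
        apply Function.Injective.bijective_of_nat_card_le
        · intro x y hxy
          have := congrArg Subtype.val hxy
          exact Subtype.ext (p.injective this)
        · exact (Nat.card_congr (r j 0)).ge)
    have h2 := MCB.CC_eq_sum τ W hcover hdisj r hr p π (fun _ _ => rfl)
    have h3 : MCB.CC (τ 0) (τ 1) (τ 2) p ≤ ∑ j, M j := by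
      rw [h2]
      exact Finset.sum_le_sum (fun j _ => (hM j).2 (π j))
    rw [hC0]
    omega
  -- lower bound
  choose π hπ using fun j => (hM j).1
  choose idx hidx using hcover
  let pf : Fin n → Fin n := fun x => (π (idx x) ⟨x, hidx x⟩ : Fin n)
  have hpf : ∀ j (x : W j), (π j x : Fin n) = pf x := by
    rintro j ⟨x, hx⟩
    have : j = idx x := hdisj x _ _ hx (hidx x)
    subst this
    rfl
  have hpfi : Function.Injective pf := by
    intro x y hxy
    have h1 : pf x ∈ (⇑(τ 0) '' W (idx x) : Set (Fin n)) := Subtype.property _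
    have h2 : pf y ∈ (⇑(τ 0) '' W (idx y) : Set (Fin n)) := Subtype.property _
    obtain ⟨u, hu, hu'⟩ := h1
    obtain ⟨v, hv, hv'⟩ := h2
    have huv : u = v := (τ 0).injective (hu'.trans (hxy.trans hv'.symm))
    rw [← huv] at hv
    have hij := hdisj _ _ _ hu hv
    have hy : y ∈ W (idx x) := hij ▸ hidx y
    have h3 := hpf (idx x) ⟨x, hidx x⟩
    have h4 := hpf (idx x) ⟨y, hy⟩
    have h5 : π (idx x) ⟨x, hidx x⟩ = π (idx x) ⟨y, hy⟩ := by
      apply Subtype.ext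
      rw [h3, h4]
      exact hxy
    exact congrArg Subtype.val ((π (idx x)).injective h5)
  let p : Equiv.Perm (Fin n) := Equiv.ofBijective pf (Finite.injective_iff_bijective.mp hpfi)
  have h2 := MCB.CC_eq_sum τ W (fun x => ⟨idx x, hidx x⟩) hdisj r hr p π hpf
  simp only [hπ] at h2
  obtain ⟨s, hs1, hs2⟩ := MCB.exists_connected (τ 0) (τ 1) (τ 2) m p (by
    rw [← hnb]
    exact MCB.nb_le_of_le le_sup_left)
  rw [← MCB.connected_iff] at hs1
  have h3 := upper s hs1
  rw [h2, ← hC0] at hs2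
  refine ⟨C0 (withZero s τ), by omega, ⟨s, hs1, rfl⟩, ?_⟩
  intro s' hs'
  have := upper s' hs'
  omega
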